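/- For all n ≥ 1, reg (I+J)^n/(I+J)^{n+1} = max_{i+j=n, i,j ≥ 0} { reg I^i/I^{i+1} + reg J^j/J^{j+1} }, where I^i/I^{i+1} is regarded as an A-module and J^j/J^{j+1} as a B-module. -/

import Mathlib

/-! Core definitions: depth via local cohomology at the maximal homogeneous ideal,
Castelnuovo–Mumford regularity via graded free resolutions, gradings on
subquotients of polynomial rings.  -/

open MvPolynomial

noncomputable section

namespace PaperHTT

variable (k : Type) [Field k]

/-- A polynomial is homogeneous of degree `e : ℤ` (it must vanish in negative degrees). -/
def homogZ {σ : Type} (p : MvPolynomial σ k) (e : ℤ) : Prop :=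
  p = 0 ∨ (0 ≤ e ∧ p.IsHomogeneous e.toNat)

/-- The maximal homogeneous ideal `(x_1, …, x_r)` of a polynomial ring. -/
def maxHomIdeal (σ : Type) : Ideal (MvPolynomial σ k) :=
  Ideal.span (Set.range MvPolynomial.X)

/-- The depth of a module over a polynomial ring with respect to the maximal homogeneous
ideal: the least `i` such that the `i`-th local cohomology is non-vanishing. -/
def depthM {σ : Type} (M : ModuleCat (MvPolynomial σ k)) : ℕ :=
  sInf {i : ℕ | Nontrivial ((localCohomology (maxHomIdeal k σ) i).obj M)}

/-- The subquotient `p/q` of a polynomial ring, for ideals `q ≤ p`. -/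
abbrev subQuot {σ : Type} (p q : Ideal (MvPolynomial σ k)) : Type :=
  ↥p ⧸ (Submodule.comap p.subtype q)

/-- The degree-`t` graded piece of `p/q`: the image of the homogeneous elements of
degree `t` of `p`. -/
def subQuotGr {σ : Type} (p q : Ideal (MvPolynomial σ k)) (t : ℤ) :
    AddSubgroup (subQuot k p q) :=
  AddSubgroup.closure
    {x | ∃ f : p, homogZ k (f : MvPolynomial σ k) t ∧ x = Submodule.Quotient.mk f}

/-- The degree-`t` graded piece of the quotient ring `P/Q`. -/
def quotGr {σ : Type} (Q : Ideal (MvPolynomial σ k)) (t : ℤ) :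
    AddSubgroup (MvPolynomial σ k ⧸ Q) :=
  AddSubgroup.closure {x | ∃ f, homogZ k f t ∧ x = Ideal.Quotient.mk Q f}

/-- The degree-`t` graded piece of an ideal `p`, viewed as a module. -/
def idealGr {σ : Type} (p : Ideal (MvPolynomial σ k)) (t : ℤ) : AddSubgroup ↥p :=
  AddSubgroup.closure {x : p | homogZ k (x : MvPolynomial σ k) t}

/-- A finite graded free resolution of a module `M` over a polynomial ring,
with respect to a grading `gr` of `M`: `F_i` is free of rank `rk i`, with basis elements
of (twisted) degrees `tw i l`, the differentials and augmentation are graded of degree `0`,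
and the complex `⋯ → F_1 → F_0 → M → 0` is exact. -/
structure GradedFreeRes (σ : Type) (M : Type) [AddCommGroup M]
    [Module (MvPolynomial σ k) M] (gr : ℤ → AddSubgroup M) where
  rk : ℕ → ℕ
  tw : (i : ℕ) → Fin (rk i) → ℤ
  bdd : ∃ N, ∀ i, N ≤ i → rk i = 0
  aug : (Fin (rk 0) → MvPolynomial σ k) →ₗ[MvPolynomial σ k] M
  d : (i : ℕ) →
    ((Fin (rk (i + 1)) → MvPolynomial σ k) →ₗ[MvPolynomial σ k]
      (Fin (rk i) → MvPolynomial σ k))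
  aug_surj : Function.Surjective aug
  exact_zero : LinearMap.range (d 0) = LinearMap.ker aug
  exact_succ : ∀ i, LinearMap.range (d (i + 1)) = LinearMap.ker (d i)
  aug_homog : ∀ l, aug (Pi.single l 1) ∈ gr (tw 0 l)
  d_homog : ∀ i l l', homogZ k (d i (Pi.single l 1) l') (tw (i + 1) l - tw i l')

/-- The Castelnuovo–Mumford regularity of a (finitely generated) graded module over a
polynomial ring: the least `r` such that `M` admits a graded free resolution with all
twists in homological degree `i` at most `r + i`.  (By minimal free resolutions, this
agrees with `max {aⁱ(M) + i}`.) -/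
def regM (σ : Type) (M : Type) [AddCommGroup M] [Module (MvPolynomial σ k) M]
    (gr : ℤ → AddSubgroup M) : ℤ :=
  sInf {r : ℤ | ∃ F : GradedFreeRes k σ M gr, ∀ i (l : Fin (F.rk i)), F.tw i l - (i : ℤ) ≤ r}

/-- Depth of the quotient ring `P/Q` as a module over `P`. -/
def depthQuot {σ : Type} (Q : Ideal (MvPolynomial σ k)) : ℕ :=
  depthM k (ModuleCat.of (MvPolynomial σ k) (MvPolynomial σ k ⧸ Q))

/-- Depth of the subquotient `p/q` as a module over the polynomial ring. -/
def depthSubQuot {σ : Type} (p q : Ideal (MvPolynomial σ k)) : ℕ :=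
  depthM k (ModuleCat.of (MvPolynomial σ k) (subQuot k p q))

/-- Depth of an ideal `p` as a module over the polynomial ring. -/
def depthIdeal {σ : Type} (p : Ideal (MvPolynomial σ k)) : ℕ :=
  depthM k (ModuleCat.of (MvPolynomial σ k) ↥p)

/-- Regularity of the quotient ring `P/Q`. -/
def regQuot {σ : Type} (Q : Ideal (MvPolynomial σ k)) : ℤ :=
  regM k σ (MvPolynomial σ k ⧸ Q) (quotGr k Q)

/-- Regularity of the subquotient `p/q`. -/
def regSubQuot {σ : Type} (p q : Ideal (MvPolynomial σ k)) : ℤ :=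
  regM k σ (subQuot k p q) (subQuotGr k p q)

/-- Regularity of an ideal `p`, viewed as a graded module. -/
def regIdeal {σ : Type} (p : Ideal (MvPolynomial σ k)) : ℤ :=
  regM k σ (↥p) (idealGr k p)

/-- A homogeneous ideal: one containing all homogeneous components of its elements. -/
def IsHomogeneousIdeal {σ : Type} (I : Ideal (MvPolynomial σ k)) : Prop :=
  ∀ f ∈ I, ∀ m : ℕ, MvPolynomial.homogeneousComponent m f ∈ I

/-- A monomial ideal. -/
def IsMonomialIdeal {σ : Type} (I : Ideal (MvPolynomial σ k)) : Prop :=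
  ∃ S : Set (σ →₀ ℕ), I = Ideal.span ((fun a => MvPolynomial.monomial a (1 : k)) '' S)

/-- A squarefree monomial ideal. -/
def IsSquarefreeMonomialIdeal {σ : Type} (I : Ideal (MvPolynomial σ k)) : Prop :=
  ∃ S : Set (σ →₀ ℕ), (∀ a ∈ S, ∀ x, a x ≤ 1) ∧
    I = Ideal.span ((fun a => MvPolynomial.monomial a (1 : k)) '' S)


/-- The quotient ring `P/Q` is Cohen–Macaulay: its depth equals its Krull dimension. -/
def IsCMQuot {σ : Type} (Q : Ideal (MvPolynomial σ k)) : Prop :=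
  (depthQuot k Q : WithBot (WithTop ℕ)) = ringKrullDim (MvPolynomial σ k ⧸ Q)

/-- An isomorphism of graded modules: a linear isomorphism matching up the gradings. -/
def GradedIso {P : Type} [CommRing P] {M N : Type} [AddCommGroup M] [Module P M]
    [AddCommGroup N] [Module P N] (grM : ℤ → AddSubgroup M) (grN : ℤ → AddSubgroup N) :
    Prop :=
  ∃ e : M ≃ₗ[P] N, ∀ t, (grM t).map e.toLinearMap.toAddMonoidHom = grN t

/-- `gr` is an (internal, ℤ-) grading of the module `M` over a polynomial ring,
compatible with the standard grading of the polynomial ring. -/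
def IsGrading (σ : Type) {M : Type} [AddCommGroup M] [Module (MvPolynomial σ k) M]
    (gr : ℤ → AddSubgroup M) : Prop :=
  DirectSum.IsInternal (fun t : ℤ => gr t) ∧
    ∀ (p : MvPolynomial σ k) (d : ℕ) (t : ℤ) (m : M), p.IsHomogeneous d → m ∈ gr t →
      p • m ∈ gr (t + d)

/-- The polynomial ring `A = k[x_1,…,x_r]`. -/
abbrev PA (r : ℕ) : Type := MvPolynomial (Fin r) k

/-- The polynomial ring `B = k[y_1,…,y_s]`. -/
abbrev PB (s : ℕ) : Type := MvPolynomial (Fin s) k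

/-- The polynomial ring `R = k[x_1,…,x_r,y_1,…,y_s]`. -/
abbrev PR (r s : ℕ) : Type := MvPolynomial (Fin r ⊕ Fin s) k

/-- The extension of an ideal `I ⊆ A` to `R`. -/
def extA {r s : ℕ} (I : Ideal (PA k r)) : Ideal (PR k r s) :=
  I.map (MvPolynomial.rename (Sum.inl : Fin r → Fin r ⊕ Fin s))

/-- The extension of an ideal `J ⊆ B` to `R`. -/
def extB {r s : ℕ} (J : Ideal (PB k s)) : Ideal (PR k r s) :=
  J.map (MvPolynomial.rename (Sum.inr : Fin s → Fin r ⊕ Fin s))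

/-- The ideal `I + J ⊆ R`. -/
def sumIJ {r s : ℕ} (I : Ideal (PA k r)) (J : Ideal (PB k s)) : Ideal (PR k r s) :=
  extA k I + extB k J

end PaperHTT

end

namespace PaperHTT

open TensorProduct

/-- A representation of the canonical anticommutation relations on the set of modes `σ`, with
a vacuum vector and a projection `p` onto the even part. It plays the role of the exterior algebra
in the Koszul complex: `e a` is multiplication by a generator, `i a` is contraction. -/
structure CAR (k : Type) [Field k] (σ : Type) where
  Λ : Type
  [grp : AddCommGroup Λ]
  [mod : Module k Λ]
  e : σ → Module.End k Λ
  i : σ → Module.End k Λ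
  p : Module.End k Λ
  vac : Λ
  ev : Λ →ₗ[k] k
  e_sq : ∀ a, e a * e a = 0
  i_sq : ∀ a, i a * i a = 0
  e_anti : ∀ a b, e a * e b = -(e b * e a)
  i_anti : ∀ a b, i a * i b = -(i b * i a)
  i_e_same : ∀ a, i a * e a = 1 - e a * i a
  i_e_ne : ∀ a b, a ≠ b → i a * e b = -(e b * i a)
  p_idem : p * p = p
  p_e : ∀ a, p * e a = e a * (1 - p)
  p_i : ∀ a, p * i a = i a * (1 - p)
  i_vac : ∀ a, i a vac = 0
  ev_vac : ev vac = 1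

attribute [instance] CAR.grp CAR.mod

namespace CAR

variable {k : Type} [Field k] {σ τ : Type}

/-- The grading involution. -/
def ε (G : CAR k σ) : Module.End k G.Λ := G.p + G.p - 1

lemma ε_sq (G : CAR k σ) : G.ε * G.ε = 1 := by
  have h := G.p_idem
  have : G.ε * G.ε = G.p * G.p + G.p * G.p + G.p * G.p + G.p * G.p - G.p - G.p - G.p - G.p + 1 := by
    unfold ε; noncomm_ring
  rw [this, h]; abel

lemma ε_anti_of (G : CAR k σ) {x : Module.End k G.Λ} (h : G.p * x = x * (1 - G.p)) :
    G.ε * x = -(x * G.ε) := by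
  have : G.ε * x = G.p * x + G.p * x - x := by unfold ε; noncomm_ring
  rw [this, h]; unfold ε; noncomm_ring

lemma ε_e (G : CAR k σ) (a : σ) : G.ε * G.e a = -(G.e a * G.ε) := G.ε_anti_of (G.p_e a)

lemma ε_i (G : CAR k σ) (a : σ) : G.ε * G.i a = -(G.i a * G.ε) := G.ε_anti_of (G.p_i a)

lemma p_ε (G : CAR k σ) : G.p * G.ε = G.ε * G.p := by unfold ε; noncomm_ring

/-- The representation on no modes. -/
def empty (h : σ → False) : CAR k σ where
  Λ := k
  e := fun _ => 0
  i := fun _ => 0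
  p := 1
  vac := 1
  ev := LinearMap.id
  e_sq := fun a => (h a).elim
  i_sq := fun a => (h a).elim
  e_anti := fun a => (h a).elim
  i_anti := fun a => (h a).elim
  i_e_same := fun a => (h a).elim
  i_e_ne := fun a => (h a).elim
  p_idem := by simp
  p_e := fun a => (h a).elim
  p_i := fun a => (h a).elim
  i_vac := fun a => (h a).elim
  ev_vac := rfl

/-- The two-dimensional representation on a single mode. -/
def single [Subsingleton σ] : CAR k σ where
  Λ := k × k
  e := fun _ => LinearMap.prod 0 (LinearMap.fst k k k)
  i := fun _ => LinearMap.prod (LinearMap.snd k k k) 0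
  p := LinearMap.prod (LinearMap.fst k k k) 0
  vac := (1, 0)
  ev := LinearMap.fst k k k
  e_sq := fun a => by ext <;> simp
  i_sq := fun a => by ext <;> simp
  e_anti := fun a b => by ext <;> simp
  i_anti := fun a b => by ext <;> simp
  i_e_same := fun a => by ext <;> simp
  i_e_ne := fun a b h => (h (Subsingleton.elim a b)).elim
  p_idem := by ext <;> simp
  p_e := fun a => by ext <;> simp
  p_i := fun a => by ext <;> simp
  i_vac := fun a => by simp
  ev_vac := rfl

/-- Relabelling the modes. -/
def congr (G : CAR k σ) (f : τ ≃ σ) : CAR k τ where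
  Λ := G.Λ
  e := fun a => G.e (f a)
  i := fun a => G.i (f a)
  p := G.p
  vac := G.vac
  ev := G.ev
  e_sq := fun _ => G.e_sq _
  i_sq := fun _ => G.i_sq _
  e_anti := fun _ _ => G.e_anti _ _
  i_anti := fun _ _ => G.i_anti _ _
  i_e_same := fun _ => G.i_e_same _
  i_e_ne := fun _ _ h => G.i_e_ne _ _ (fun h' => h (f.injective h'))
  p_idem := G.p_idem
  p_e := fun _ => G.p_e _
  p_i := fun _ => G.p_i _
  i_vac := fun _ => G.i_vac _
  ev_vac := G.ev_vac

/-- The graded tensor product of two representations. -/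
def sum (G : CAR k σ) (H : CAR k τ) : CAR k (σ ⊕ τ) where
  Λ := G.Λ ⊗[k] H.Λ
  e := Sum.elim (fun a => TensorProduct.map (G.e a) 1) (fun b => TensorProduct.map G.ε (H.e b))
  i := Sum.elim (fun a => TensorProduct.map (G.i a) 1) (fun b => TensorProduct.map G.ε (H.i b))
  p := TensorProduct.map G.p H.p + TensorProduct.map (1 - G.p) (1 - H.p)
  vac := G.vac ⊗ₜ H.vac
  ev := LinearMap.mul' k k ∘ₗ TensorProduct.map G.ev H.ev
  e_sq := by
    rintro (a | b)
    · simp [← TensorProduct.map_mul, G.e_sq, TensorProduct.map_zero_left]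
    · simp [← TensorProduct.map_mul, H.e_sq, TensorProduct.map_zero_right]
  i_sq := by
    rintro (a | b)
    · simp [← TensorProduct.map_mul, G.i_sq, TensorProduct.map_zero_left]
    · simp [← TensorProduct.map_mul, H.i_sq, TensorProduct.map_zero_right]
  e_anti := by
    rintro (a | b) (c | d)
    · simp only [Sum.elim_inl, ← TensorProduct.map_mul, G.e_anti a c]
      ext; simp [TensorProduct.neg_tmul]
    · simp only [Sum.elim_inl, Sum.elim_inr, ← TensorProduct.map_mul, G.ε_e]
      ext; simp [TensorProduct.neg_tmul]
    · simp only [Sum.elim_inl, Sum.elim_inr, ← TensorProduct.map_mul, G.ε_e]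
      ext; simp [TensorProduct.neg_tmul]
    · simp only [Sum.elim_inr, ← TensorProduct.map_mul, H.e_anti b d]
      ext; simp [TensorProduct.tmul_neg]
  i_anti := by
    rintro (a | b) (c | d)
    · simp only [Sum.elim_inl, ← TensorProduct.map_mul, G.i_anti a c]
      ext; simp [TensorProduct.neg_tmul]
    · simp only [Sum.elim_inl, Sum.elim_inr, ← TensorProduct.map_mul, G.ε_i]
      ext; simp [TensorProduct.neg_tmul]
    · simp only [Sum.elim_inl, Sum.elim_inr, ← TensorProduct.map_mul, G.ε_i]
      ext; simp [TensorProduct.neg_tmul]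
    · simp only [Sum.elim_inr, ← TensorProduct.map_mul, H.i_anti b d]
      ext; simp [TensorProduct.tmul_neg]
  i_e_same := by
    rintro (a | b)
    · simp only [Sum.elim_inl, ← TensorProduct.map_mul, G.i_e_same a]
      ext; simp [TensorProduct.sub_tmul]
    · simp only [Sum.elim_inr, ← TensorProduct.map_mul, H.i_e_same b, G.ε_sq]
      ext; simp [TensorProduct.tmul_sub]
  i_e_ne := by
    rintro (a | b) (c | d) h
    · simp only [Sum.elim_inl, ← TensorProduct.map_mul, G.i_e_ne a c (fun h' => h (by rw [h']))]
      ext; simp [TensorProduct.neg_tmul]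
    · simp only [Sum.elim_inl, Sum.elim_inr, ← TensorProduct.map_mul, G.ε_i]
      ext; simp [TensorProduct.neg_tmul]
    · simp only [Sum.elim_inl, Sum.elim_inr, ← TensorProduct.map_mul, G.ε_e]
      ext; simp [TensorProduct.neg_tmul]
    · simp only [Sum.elim_inr, ← TensorProduct.map_mul, H.i_e_ne b d (fun h' => h (by rw [h']))]
      ext; simp [TensorProduct.tmul_neg]
  p_idem := by
    have h1 : G.p * (1 - G.p) = 0 := by rw [mul_sub, mul_one, G.p_idem, sub_self]
    have h2 : (1 - G.p) * G.p = 0 := by rw [sub_mul, one_mul, G.p_idem, sub_self]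
    have h3 : (1 - G.p) * (1 - G.p) = 1 - G.p := by rw [mul_sub, h2, mul_one, sub_zero]
    have h4 : H.p * (1 - H.p) = 0 := by rw [mul_sub, mul_one, H.p_idem, sub_self]
    have h5 : (1 - H.p) * H.p = 0 := by rw [sub_mul, one_mul, H.p_idem, sub_self]
    have h6 : (1 - H.p) * (1 - H.p) = 1 - H.p := by rw [mul_sub, h5, mul_one, sub_zero]
    simp only [mul_add, add_mul, ← TensorProduct.map_mul, G.p_idem, H.p_idem, h1, h2, h3, h6,
      TensorProduct.map_zero_left, add_zero, zero_add]
  p_e := by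
    have hG : ∀ a, (1 - G.p) * G.e a = G.e a * G.p := fun a => by
      rw [sub_mul, G.p_e]; noncomm_ring
    have hH : ∀ a, (1 - H.p) * H.e a = H.e a * H.p := fun a => by
      rw [sub_mul, H.p_e]; noncomm_ring
    have hε : (1 - G.p) * G.ε = G.ε * (1 - G.p) := by rw [sub_mul, G.p_ε]; noncomm_ring
    rintro (a | b)
    · simp only [Sum.elim_inl, mul_sub, mul_add, add_mul, ← TensorProduct.map_mul, G.p_e, hG]
      ext; simp [TensorProduct.tmul_sub, TensorProduct.sub_tmul]; abel
    · simp only [Sum.elim_inr, mul_sub, mul_add, add_mul, ← TensorProduct.map_mul, H.p_e, hH, G.p_ε,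
        hε]
      ext; simp [TensorProduct.tmul_sub, TensorProduct.sub_tmul]; abel
  p_i := by
    have hG : ∀ a, (1 - G.p) * G.i a = G.i a * G.p := fun a => by
      rw [sub_mul, G.p_i]; noncomm_ring
    have hH : ∀ a, (1 - H.p) * H.i a = H.i a * H.p := fun a => by
      rw [sub_mul, H.p_i]; noncomm_ring
    have hε : (1 - G.p) * G.ε = G.ε * (1 - G.p) := by rw [sub_mul, G.p_ε]; noncomm_ring
    rintro (a | b)
    · simp only [Sum.elim_inl, mul_sub, mul_add, add_mul, ← TensorProduct.map_mul, G.p_i, hG]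
      ext; simp [TensorProduct.tmul_sub, TensorProduct.sub_tmul]; abel
    · simp only [Sum.elim_inr, mul_sub, mul_add, add_mul, ← TensorProduct.map_mul, H.p_i, hH, G.p_ε,
        hε]
      ext; simp [TensorProduct.tmul_sub, TensorProduct.sub_tmul]; abel
  i_vac := by rintro (a | b) <;> simp [G.i_vac, H.i_vac]
  ev_vac := by simp [G.ev_vac, H.ev_vac]

variable (k) in
/-- A representation on `n` modes. -/
def fin : (n : ℕ) → CAR k (Fin n)
  | 0 => empty (fun a => a.elim0)
  | n + 1 => ((fin n).sum (single (σ := Fin 1))).congr finSumFinEquiv.symm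

end CAR
section Koszul

variable {k : Type} [Field k] {σ : Type} (G : CAR k σ)
variable {V W : Type} [AddCommGroup V] [Module k V] [AddCommGroup W] [Module k W]

/-- A grading of `V` by projections, for which the operators `X` have degree one. -/
structure Grd (X : σ → Module.End k V) where
  proj : ℤ → Module.End k V
  idem : ∀ t v, proj t (proj t v) = proj t v
  orth : ∀ s t v, s ≠ t → proj s (proj t v) = 0
  op : ∀ t a v, proj (t + 1) (X a v) = X a (proj t v)
  fin : ∀ v, ∃ s : Finset ℤ, ∑ t ∈ s, proj t v = v

section Projection

variable {G}
variable {X : σ → Module.End k V} (g : Grd X)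

/-- The projection of the Koszul complex onto the part with coefficients of degree `t`. -/
noncomputable def Grd.kproj (G : CAR k σ) (t : ℤ) : Module.End k (G.Λ ⊗[k] V) :=
  (g.proj t).lTensor G.Λ

lemma Grd.kproj_tmul (t : ℤ) (x : G.Λ) (v : V) : g.kproj G t (x ⊗ₜ v) = x ⊗ₜ g.proj t v := rfl

lemma Grd.kproj_idem (t : ℤ) (z : G.Λ ⊗[k] V) : g.kproj G t (g.kproj G t z) = g.kproj G t z := by
  induction z with
  | zero => simp
  | add x y hx hy => simp [hx, hy]
  | tmul x v => simp [kproj_tmul, g.idem]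

lemma Grd.kproj_orth (s t : ℤ) (h : s ≠ t) (z : G.Λ ⊗[k] V) :
    g.kproj G s (g.kproj G t z) = 0 := by
  induction z with
  | zero => simp
  | add x y hx hy => simp [hx, hy]
  | tmul x v => simp [kproj_tmul, g.orth s t v h]

lemma Grd.kproj_eq_zero_of_ne {s t : ℤ} (h : s ≠ t) {z : G.Λ ⊗[k] V} (hz : g.kproj G t z = z) :
    g.kproj G s z = 0 := by
  rw [← hz, g.kproj_orth s t h]

end Projection

section Differential

variable [Fintype σ]

/-- The Koszul differential on `Λ ⊗ V` of a family of operators `X` on `V`. -/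
noncomputable def koszulD (X : σ → Module.End k V) : Module.End k (G.Λ ⊗[k] V) :=
  ∑ a, TensorProduct.map (G.i a) (X a)

lemma koszulD_tmul (X : σ → Module.End k V) (x : G.Λ) (v : V) :
    koszulD G X (x ⊗ₜ v) = ∑ a, G.i a x ⊗ₜ[k] X a v := by
  simp [koszulD, LinearMap.sum_apply]

lemma koszulD_mul_self {X : σ → Module.End k V} (hX : ∀ a b, X a * X b = X b * X a) :
    koszulD G X * koszulD G X = 0 := by
  classical
  unfold koszulD
  rw [Finset.sum_mul_sum, ← Finset.sum_product']
  refine Finset.sum_involution (fun x _ => (x.2, x.1)) ?_ ?_ (by simp) (by simp)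
  · rintro ⟨a, b⟩ -
    simp only [← TensorProduct.map_mul, G.i_anti a b, hX a b]
    ext; simp [TensorProduct.neg_tmul]
  · rintro ⟨a, b⟩ - h h'
    simp only [Prod.mk.injEq] at h'
    apply h
    rw [h'.1, ← TensorProduct.map_mul, G.i_sq, TensorProduct.map_zero_left]

lemma koszulD_koszulD {X : σ → Module.End k V} (hX : ∀ a b, X a * X b = X b * X a)
    (z : G.Λ ⊗[k] V) : koszulD G X (koszulD G X z) = 0 :=
  LinearMap.congr_fun (koszulD_mul_self G hX) z

lemma koszulD_lTensor {X : σ → Module.End k V} {Y : σ → Module.End k W} (f : V →ₗ[k] W)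
    (h : ∀ a v, f (X a v) = Y a (f v)) (z : G.Λ ⊗[k] V) :
    koszulD G Y (f.lTensor G.Λ z) = f.lTensor G.Λ (koszulD G X z) := by
  induction z with
  | zero => simp
  | add x y hx hy => simp [hx, hy]
  | tmul x v => simp [koszulD_tmul, h]

variable {G}
variable {X : σ → Module.End k V} (g : Grd X)

lemma Grd.kproj_koszulD (t : ℤ) (z : G.Λ ⊗[k] V) :
    g.kproj G (t + 1) (koszulD G X z) = koszulD G X (g.kproj G t z) := by
  induction z with
  | zero => simp
  | add x y hx hy => simp [hx, hy]
  | tmul x v => simp [kproj_tmul, koszulD_tmul, g.op]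

/-- Regularity at most `r`: the Koszul complex is exact in slopes above `r`. -/
def Grd.RegLE (G : CAR k σ) (r : ℤ) : Prop :=
  ∀ t, r < t → ∀ z : G.Λ ⊗[k] V, g.kproj G t z = z → koszulD G X z = 0 →
    ∃ w, koszulD G X w = z

variable {g}

lemma Grd.RegLE.mono {r r' : ℤ} (h : g.RegLE G r) (hr : r ≤ r') : g.RegLE G r' :=
  fun t ht => h t (lt_of_le_of_lt hr ht)

lemma Grd.RegLE.exists_kproj {r : ℤ} (h : g.RegLE G r) {t : ℤ} (ht : r < t) {z : G.Λ ⊗[k] V}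
    (hz : g.kproj G t z = z) (hd : koszulD G X z = 0) :
    ∃ w, g.kproj G (t - 1) w = w ∧ koszulD G X w = z := by
  obtain ⟨w, hw⟩ := h t ht z hz hd
  refine ⟨g.kproj G (t - 1) w, g.kproj_idem _ _, ?_⟩
  rw [← g.kproj_koszulD, hw, sub_add_cancel, hz]

variable (g) (G) in
lemma Grd.exists_homotopy (hX : ∀ a b, X a * X b = X b * X a) {r : ℤ} (h : g.RegLE G r) (N : ℤ) :
    ∃ H : Module.End k (G.Λ ⊗[k] V), ∀ t, r < t → t ≤ N → ∀ z, g.kproj G t z = z →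
      koszulD G X (H z) + H (koszulD G X z) = z := by
  set d := koszulD G X with hd
  have hdd : ∀ z, d (d z) = 0 := koszulD_koszulD G hX
  obtain ⟨τ, hτ⟩ : ∃ τ : Module.End k (G.Λ ⊗[k] V), ∀ z, d (τ (d z)) = d z := by
    obtain ⟨s, hs⟩ := LinearMap.exists_rightInverse_of_surjective d.rangeRestrict
      d.range_rangeRestrict
    obtain ⟨q, hq⟩ := s.exists_extend
    refine ⟨q, fun z => ?_⟩
    have h1 : q (d z) = s ⟨d z, d.mem_range_self z⟩ := LinearMap.congr_fun hq ⟨d z, _⟩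
    rw [h1]
    exact congrArg Subtype.val (LinearMap.congr_fun hs ⟨d z, d.mem_range_self z⟩)
  let H₀ : ℤ → Module.End k (G.Λ ⊗[k] V) := fun t =>
    g.kproj G (t - 1) * τ * (1 - g.kproj G t * τ * d)
  refine ⟨∑ t ∈ Finset.Ioc r (N + 1), H₀ t * g.kproj G t, fun t ht htN z hz => ?_⟩
  have key : ∀ t, r < t → t ≤ N + 1 → ∀ z, g.kproj G t z = z →
      (∑ t ∈ Finset.Ioc r (N + 1), H₀ t * g.kproj G t) z = H₀ t z := by
    intro t ht htN z hz
    rw [LinearMap.sum_apply, Finset.sum_eq_single t]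
    · rw [Module.End.mul_apply, hz]
    · intro s _ hs
      rw [Module.End.mul_apply, g.kproj_eq_zero_of_ne hs hz, map_zero]
    · intro h'; exact absurd (Finset.mem_Ioc.2 ⟨ht, htN⟩) h'
  have hdz : g.kproj G (t + 1) (d z) = d z := by rw [hd, g.kproj_koszulD, hz]
  rw [key t ht (by omega) z hz, key (t + 1) (by omega) (by omega) _ hdz]
  simp only [H₀, Module.End.mul_apply, LinearMap.sub_apply, Module.End.one_apply, hdd, map_zero,
    sub_zero, add_sub_cancel_right]
  set y := z - g.kproj G t (τ (d z)) with hy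
  have hyp : g.kproj G t y = y := by rw [hy, map_sub, hz, g.kproj_idem]
  have hyd : d y = 0 := by
    rw [hy, map_sub, hd, ← g.kproj_koszulD, ← hd, hτ, hdz, sub_self]
  obtain ⟨w, hw⟩ := h t ht y hyp hyd
  have : d (g.kproj G (t - 1) (τ y)) = y := by
    rw [hd, ← g.kproj_koszulD, ← hd, sub_add_cancel, ← hw, ← hd, hτ, hd, hw, hyp]
  rw [this, hy]; abel

variable (X) (G) in
lemma koszulD_p (z : G.Λ ⊗[k] V) :
    koszulD G X (G.p.rTensor V z) = koszulD G X z - G.p.rTensor V (koszulD G X z) := by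
  induction z with
  | zero => simp
  | add x y hx hy => simp only [map_add, hx, hy]; abel
  | tmul x v =>
    have h : ∀ a, G.i a (G.p x) = G.i a x - G.p (G.i a x) := fun a => by
      have := LinearMap.congr_fun (G.p_i a) x
      simp only [Module.End.mul_apply, LinearMap.sub_apply, Module.End.one_apply, map_sub] at this
      rw [this]; abel
    simp [koszulD_tmul, h, TensorProduct.sub_tmul, Finset.sum_sub_distrib]

variable (g) (G) in
lemma Grd.exists_odd_homotopy (hX : ∀ a b, X a * X b = X b * X a) {r : ℤ} (h : g.RegLE G r)
    (N : ℤ) :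
    ∃ H : Module.End k (G.Λ ⊗[k] V), G.ε.rTensor V * H = -(H * G.ε.rTensor V) ∧
      ∀ t, r < t → t ≤ N → ∀ z, g.kproj G t z = z →
        koszulD G X (H z) + H (koszulD G X z) = z := by
  obtain ⟨H, hH⟩ := g.exists_homotopy G hX h N
  set P : Module.End k (G.Λ ⊗[k] V) := G.p.rTensor V with hP
  have hPP : P * P = P := by
    rw [hP, Module.End.mul_eq_comp, ← LinearMap.rTensor_comp, ← Module.End.mul_eq_comp, G.p_idem]
  have hε : G.ε.rTensor V = P + P - 1 := by
    unfold CAR.ε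
    ext; simp [hP]
  have hdP : ∀ z, koszulD G X (P z) = koszulD G X z - P (koszulD G X z) := koszulD_p G X
  have hPP' : ∀ z, P (P z) = P z := LinearMap.congr_fun hPP
  refine ⟨P * H * (1 - P) + (1 - P) * H * P, ?_, fun t ht htN z hz => ?_⟩
  · rw [hε]
    refine LinearMap.ext fun z => ?_
    simp only [Module.End.mul_apply, LinearMap.sub_apply, LinearMap.add_apply, LinearMap.neg_apply,
      map_sub, map_add, Module.End.one_apply, hPP']
    abel
  · have hPz : g.kproj G t (P z) = P z := by
      have : ∀ z, g.kproj G t (P z) = P (g.kproj G t z) := by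
        intro z
        induction z with
        | zero => simp
        | add x y hx hy => simp only [map_add, hx, hy]
        | tmul x v => rfl
      rw [this, hz]
    have e1 := congrArg P (hH t ht htN _ hPz)
    have e2 := hH t ht htN (z - P z) (by rw [map_sub, hz, hPz])
    have e3 := congrArg P e2
    simp only [map_sub, map_add, hdP, hPP'] at e1 e2 e3
    simp only [Module.End.mul_apply, LinearMap.sub_apply, LinearMap.add_apply, map_sub, map_add,
      Module.End.one_apply, hdP]
    linear_combination (norm := abel) e1 + e2 - e3

end Differential

end Koszul
section KunnethAbstract

variable {k : Type} [Field k]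
variable {C D : Type} [AddCommGroup C] [Module k C] [AddCommGroup D] [Module k D]

/-- The differential of a tensor product of complexes, `E` being the sign on the first factor. -/
noncomputable def tensorD (d E : Module.End k C) (d' : Module.End k D) :
    Module.End k (C ⊗[k] D) :=
  TensorProduct.map d 1 + TensorProduct.map E d'

lemma tensorD_tmul (d E : Module.End k C) (d' : Module.End k D) (x : C) (y : D) :
    tensorD d E d' (x ⊗ₜ y) = d x ⊗ₜ y + E x ⊗ₜ d' y := rfl

lemma exists_tensor_homotopy {d h E : Module.End k C} (d' h' : Module.End k D)
    (hdd : d * d = 0) (hEE : E * E = 1) (hEd : E * d = -(d * E)) (hEh : E * h = -(h * E)) :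
    ∃ S : Module.End k (C ⊗[k] D), ∀ z,
      tensorD d E d' (S z) + S (tensorD d E d' z) =
      z - TensorProduct.map (1 - d * h - h * d) (1 - d' * h' - h' * d') z := by
  have hdd' : ∀ c, d (d c) = 0 := LinearMap.congr_fun hdd
  have hEE' : ∀ c, E (E c) = c := LinearMap.congr_fun hEE
  have hEd' : ∀ c, E (d c) = -(d (E c)) := LinearMap.congr_fun hEd
  have hEh' : ∀ c, E (h c) = -(h (E c)) := LinearMap.congr_fun hEh
  refine ⟨TensorProduct.map h 1 + TensorProduct.map (E * (1 - d * h - h * d)) h', fun z => ?_⟩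
  induction z with
  | zero => simp
  | add x y hx hy =>
    simp only [map_add] at hx hy ⊢
    linear_combination (norm := abel) hx + hy
  | tmul x y =>
    simp only [LinearMap.add_apply, TensorProduct.map_tmul, tensorD_tmul, map_add, map_sub, map_neg,
      Module.End.mul_apply, Module.End.one_apply, LinearMap.sub_apply, hdd', hEE', hEd', hEh',
      TensorProduct.sub_tmul, TensorProduct.tmul_sub, TensorProduct.neg_tmul, map_zero, neg_neg,
      sub_zero, TensorProduct.zero_tmul]
    abel

lemma tmul_not_boundary {d E : Module.End k C} {d' : Module.End k D} {z : C} {w : D}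
    (hz : ∀ x, d x ≠ z) (hw : ∀ x, d' x ≠ w) (x : C ⊗[k] D) :
    tensorD d E d' x ≠ z ⊗ₜ w := by
  obtain ⟨φ, hφ, hφd⟩ := Submodule.exists_le_ker_of_notMem
    (show z ∉ LinearMap.range d by rintro ⟨y, hy⟩; exact hz y hy)
  obtain ⟨ψ, hψ, hψd⟩ := Submodule.exists_le_ker_of_notMem
    (show w ∉ LinearMap.range d' by rintro ⟨y, hy⟩; exact hw y hy)
  have h0 : ∀ x, TensorProduct.lid k k (TensorProduct.map φ ψ
      (tensorD d E d' x)) = 0 := by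
    intro x
    induction x with
    | zero => simp
    | add x y hx hy => rw [map_add, map_add, map_add, hx, hy, add_zero]
    | tmul x y =>
      have h1 : φ (d x) = 0 := hφd ⟨x, rfl⟩
      have h2 : ψ (d' y) = 0 := hψd ⟨y, rfl⟩
      simp [tensorD_tmul, h1, h2]
  intro h
  have := h0 x
  rw [h] at this
  simp [hφ, hψ] at this

end KunnethAbstract

section Kunneth

variable {k : Type} [Field k] {σ τ : Type} (G : CAR k σ) (H : CAR k τ)
variable {V W : Type} [AddCommGroup V] [Module k V] [AddCommGroup W] [Module k W]

/-- The operators on a tensor product given by operators on each factor. -/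
noncomputable def prodOp (X : σ → Module.End k V) (Y : τ → Module.End k W) :
    σ ⊕ τ → Module.End k (V ⊗[k] W) :=
  Sum.elim (fun a => TensorProduct.map (X a) 1) (fun b => TensorProduct.map 1 (Y b))

/-- The interchange of tensor factors identifying the tensor product of two Koszul complexes
with a Koszul complex. -/
noncomputable def interchange : (G.Λ ⊗[k] V) ⊗[k] (H.Λ ⊗[k] W) ≃ₗ[k]
    (G.sum H).Λ ⊗[k] (V ⊗[k] W) :=
  TensorProduct.tensorTensorTensorComm k G.Λ V H.Λ W

lemma interchange_tmul (x : G.Λ) (v : V) (y : H.Λ) (w : W) :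
    interchange G H ((x ⊗ₜ v) ⊗ₜ (y ⊗ₜ w)) = (x ⊗ₜ[k] y : G.Λ ⊗[k] H.Λ) ⊗ₜ (v ⊗ₜ w) := rfl

lemma koszulD_interchange [Fintype σ] [Fintype τ] (X : σ → Module.End k V)
    (Y : τ → Module.End k W) (z : (G.Λ ⊗[k] V) ⊗[k] (H.Λ ⊗[k] W)) :
    koszulD (G.sum H) (prodOp X Y) (interchange G H z) =
      interchange G H (tensorD (koszulD G X) (G.ε.rTensor V) (koszulD H Y) z) := by
  induction z with
  | zero => simp
  | add x y hx hy => simp only [map_add, hx, hy]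
  | tmul c c' =>
    induction c with
    | zero => simp
    | add x y hx hy => simp only [map_add, hx, hy, TensorProduct.add_tmul]
    | tmul x v =>
      induction c' with
      | zero => simp
      | add x y hx hy => simp only [map_add, hx, hy, TensorProduct.tmul_add]
      | tmul y w =>
        rw [interchange_tmul]
        refine (koszulD_tmul (G.sum H) _ _ _).trans ?_
        rw [Fintype.sum_sum_type, tensorD_tmul, koszulD_tmul, koszulD_tmul, map_add,
          TensorProduct.sum_tmul, TensorProduct.tmul_sum, map_sum, map_sum]
        rfl

variable {G H}

lemma ε_rTensor_sq : G.ε.rTensor V * G.ε.rTensor V = 1 := by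
  rw [Module.End.mul_eq_comp, ← LinearMap.rTensor_comp, ← Module.End.mul_eq_comp, G.ε_sq,
    Module.End.one_eq_id, LinearMap.rTensor_id]
  rfl

variable [Fintype σ] [Fintype τ]
variable {X : σ → Module.End k V} {Y : τ → Module.End k W} (g : Grd X) (g' : Grd Y)

lemma ε_koszulD : G.ε.rTensor V * koszulD G X = -(koszulD G X * G.ε.rTensor V) := by
  refine TensorProduct.ext' fun x v => ?_
  have : ∀ a, G.ε (G.i a x) = -(G.i a (G.ε x)) := fun a => LinearMap.congr_fun (G.ε_i a) x
  simp [koszulD_tmul, this, TensorProduct.neg_tmul]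

lemma kunneth_upper (hX : ∀ a b, X a * X b = X b * X a) (hY : ∀ a b, Y a * Y b = Y b * Y a)
    {r r' e : ℤ} (hr : g.RegLE G r) (hr' : g'.RegLE H r') (hg : ∀ t < 0, g.proj t = 0)
    (hg' : ∀ t < 0, g'.proj t = 0) (he : r + r' < e) {z : (G.sum H).Λ ⊗[k] (V ⊗[k] W)}
    (hz : z ∈ Submodule.span k {u | ∃ (l : (G.sum H).Λ) (v : V) (w : W) (a b : ℤ), a + b = e ∧
      g.proj a v = v ∧ g'.proj b w = w ∧ u = l ⊗ₜ (v ⊗ₜ w)})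
    (hd : koszulD (G.sum H) (prodOp X Y) z = 0) :
    ∃ w, koszulD (G.sum H) (prodOp X Y) w = z := by
  obtain ⟨h, hE, hh⟩ := g.exists_odd_homotopy G hX hr e
  obtain ⟨h', -, hh'⟩ := g'.exists_odd_homotopy H hY hr' e
  obtain ⟨S, hS⟩ := exists_tensor_homotopy (koszulD H Y) h' (koszulD_mul_self G hX) ε_rTensor_sq
    ε_koszulD hE
  set π := 1 - koszulD G X * h - h * koszulD G X
  set π' := 1 - koszulD H Y * h' - h' * koszulD H Y
  have hπ : ∀ a, r < a → a ≤ e → ∀ c, g.kproj G a c = c → π c = 0 := fun a ha hae c hc => by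
    have := hh a ha hae c hc
    simp only [π, LinearMap.sub_apply, Module.End.mul_apply, Module.End.one_apply]
    linear_combination (norm := abel) -this
  have hπ' : ∀ a, r' < a → a ≤ e → ∀ c, g'.kproj H a c = c → π' c = 0 := fun a ha hae c hc => by
    have := hh' a ha hae c hc
    simp only [π', LinearMap.sub_apply, Module.End.mul_apply, Module.End.one_apply]
    linear_combination (norm := abel) -this
  have hkill : TensorProduct.map π π' ((interchange G H).symm z) = 0 := by
    clear hd
    induction hz using Submodule.span_induction with
    | zero => simp
    | add x y _ _ hx hy => simp only [map_add, hx, hy, add_zero]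
    | smul c x _ hx => simp only [map_smul, hx, smul_zero]
    | mem u hu =>
      obtain ⟨l, v, w, a, b, hab, hv, hw, rfl⟩ := hu
      by_cases ha : a < 0
      · rw [← hv, hg a ha]; simp
      by_cases hb : b < 0
      · rw [← hw, hg' b hb]; simp
      let F : (G.sum H).Λ →ₗ[k] (G.Λ ⊗[k] V) ⊗[k] (H.Λ ⊗[k] W) :=
        TensorProduct.map π π' ∘ₗ (interchange G H).symm.toLinearMap ∘ₗ
          (TensorProduct.mk k (G.sum H).Λ (V ⊗[k] W)).flip (v ⊗ₜ w)
      have hF : F = 0 := by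
        refine TensorProduct.ext' (M := G.Λ) (N := H.Λ) fun x y => ?_
        have : (interchange G H).symm ((x ⊗ₜ[k] y : G.Λ ⊗[k] H.Λ) ⊗ₜ[k] (v ⊗ₜ[k] w) :
            (G.sum H).Λ ⊗[k] (V ⊗[k] W)) = (x ⊗ₜ v) ⊗ₜ (y ⊗ₜ w) := by
          rw [LinearEquiv.symm_apply_eq]; rfl
        refine (congrArg (TensorProduct.map π π') this).trans ?_
        rw [TensorProduct.map_tmul]
        by_cases har : r < a
        · rw [hπ a har (by omega) _ (by rw [g.kproj_tmul, hv]), TensorProduct.zero_tmul]; rfl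
        · rw [hπ' b (by omega) (by omega) _ (by rw [g'.kproj_tmul, hw]), TensorProduct.tmul_zero]
          rfl
      exact LinearMap.congr_fun hF l
  refine ⟨interchange G H (S ((interchange G H).symm z)), ?_⟩
  have h0 := koszulD_interchange G H X Y ((interchange G H).symm z)
  rw [LinearEquiv.apply_symm_apply, hd, eq_comm, LinearEquiv.map_eq_zero_iff] at h0
  have h1 := hS ((interchange G H).symm z)
  rw [h0, hkill, map_zero, add_zero, sub_zero] at h1
  rw [koszulD_interchange, h1, LinearEquiv.apply_symm_apply]

lemma kunneth_lower {a b : ℤ} {z : G.Λ ⊗[k] V} {w : H.Λ ⊗[k] W} (hz : g.kproj G a z = z)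
    (hw : g'.kproj H b w = w) (hdz : koszulD G X z = 0) (hdw : koszulD H Y w = 0)
    (hz' : ∀ x, koszulD G X x ≠ z) (hw' : ∀ x, koszulD H Y x ≠ w) :
    ∃ u, (TensorProduct.map (g.proj a) (g'.proj b)).lTensor (G.sum H).Λ u = u ∧
      koszulD (G.sum H) (prodOp X Y) u = 0 ∧ ∀ x, koszulD (G.sum H) (prodOp X Y) x ≠ u := by
  refine ⟨interchange G H (z ⊗ₜ w), ?_, ?_, fun x hx => ?_⟩
  · have : ∀ y, (TensorProduct.map (g.proj a) (g'.proj b)).lTensor (G.sum H).Λ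
        (interchange G H y) =
        interchange G H (TensorProduct.map (g.kproj G a) (g'.kproj H b) y) := by
      intro y
      induction y with
      | zero => simp
      | add x y hx hy => simp only [map_add, hx, hy]
      | tmul c c' =>
        induction c with
        | zero => simp
        | add x y hx hy => simp only [map_add, hx, hy, TensorProduct.add_tmul]
        | tmul x v =>
          induction c' with
          | zero => simp
          | add x y hx hy => simp only [map_add, hx, hy, TensorProduct.tmul_add]
          | tmul y w => rfl
    rw [this, TensorProduct.map_tmul, hz, hw]
  · rw [koszulD_interchange]
    simp [tensorD_tmul, hdz, hdw]
  · refine tmul_not_boundary (E := G.ε.rTensor V) hz' hw' ((interchange G H).symm x) ?_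
    apply (interchange G H).injective
    rw [← koszulD_interchange, LinearEquiv.apply_symm_apply, hx]

end Kunneth

section Filtration

variable {k : Type} [Field k] {σ : Type} (G : CAR k σ)
variable (V : Type) {W : Type} [AddCommGroup V] [Module k V] [AddCommGroup W] [Module k W]

/-- The part of `Λ ⊗ V` in exterior degrees at least `m`. -/
noncomputable def lk : ℕ → Submodule k (G.Λ ⊗[k] V)
  | 0 => ⊤
  | m + 1 => ⨆ a, (lk m).map ((G.e a).rTensor V)

variable {V}

lemma lk_induction {m : ℕ} {C : G.Λ ⊗[k] V → Prop} (zero : C 0)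
    (add : ∀ x y, C x → C y → C (x + y))
    (step : ∀ a y, y ∈ lk G V m → C ((G.e a).rTensor V y)) {z : G.Λ ⊗[k] V}
    (hz : z ∈ lk G V (m + 1)) : C z := by
  refine Submodule.iSup_induction _ (motive := C) hz ?_ zero add
  rintro a _ ⟨y, hy, rfl⟩
  exact step a y hy

variable {G}

lemma e_mem_lk {m : ℕ} (a : σ) {z : G.Λ ⊗[k] V} (hz : z ∈ lk G V m) :
    (G.e a).rTensor V z ∈ lk G V (m + 1) :=
  Submodule.mem_iSup_of_mem a ⟨z, hz, rfl⟩

lemma map_mem_lk {A : Module.End k G.Λ} (hA : ∀ b, A * G.e b = G.e b * A ∨ A * G.e b = 0)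
    (f : V →ₗ[k] W) {m : ℕ} {z : G.Λ ⊗[k] V} (hz : z ∈ lk G V m) :
    TensorProduct.map A f z ∈ lk G W m := by
  induction m generalizing z with
  | zero => trivial
  | succ m ih =>
    refine lk_induction G (C := fun z => TensorProduct.map A f z ∈ lk G W (m + 1)) (by simp)
      (fun x y hx hy => by rw [map_add]; exact Submodule.add_mem _ hx hy) (fun b y hy => ?_) hz
    have h1 : TensorProduct.map A f ((G.e b).rTensor V y) =
        TensorProduct.map (A * G.e b) f y := by
      rw [LinearMap.rTensor, ← LinearMap.comp_apply, ← TensorProduct.map_comp, LinearMap.comp_id]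
      rfl
    rw [h1]
    rcases hA b with h | h
    · have : TensorProduct.map (G.e b * A) f y = (G.e b).rTensor W (TensorProduct.map A f y) := by
        rw [← LinearMap.comp_apply, LinearMap.rTensor, ← TensorProduct.map_comp,
          LinearMap.id_comp]
        rfl
      rw [h, this]
      exact e_mem_lk b (ih hy)
    · rw [h, TensorProduct.map_zero_left]
      exact Submodule.zero_mem _

lemma lTensor_mem_lk (f : V →ₗ[k] W) {m : ℕ} {z : G.Λ ⊗[k] V} (hz : z ∈ lk G V m) :
    f.lTensor G.Λ z ∈ lk G W m :=
  map_mem_lk (A := 1) (fun b => Or.inl (by rw [one_mul, mul_one])) f hz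

lemma e_mul_prod_of_mem {a : σ} {l : List σ} (h : a ∈ l) : G.e a * (l.map G.e).prod = 0 := by
  induction l with
  | nil => simp at h
  | cons b l ih =>
    rw [List.map_cons, List.prod_cons, ← mul_assoc]
    by_cases hab : a = b
    · rw [hab, G.e_sq, zero_mul]
    · rw [G.e_anti, neg_mul, mul_assoc, ih ((List.mem_cons.1 h).resolve_left hab), mul_zero,
        neg_zero]

lemma prod_e_eq_zero {l : List σ} (h : ¬ l.Nodup) : (l.map G.e).prod = 0 := by
  induction l with
  | nil => simp at h
  | cons b l ih =>
    rw [List.map_cons, List.prod_cons]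
    rw [List.nodup_cons, not_and_or, not_not] at h
    rcases h with h | h
    · exact e_mul_prod_of_mem h
    · rw [ih h, mul_zero]

lemma prod_e_lk [Fintype σ] {m : ℕ} (l : List σ) (hl : Fintype.card σ < l.length + m)
    {z : G.Λ ⊗[k] V} (hz : z ∈ lk G V m) : ((l.map G.e).prod).rTensor V z = 0 := by
  induction m generalizing l z with
  | zero =>
    rw [prod_e_eq_zero (fun h => by have := h.length_le_card; omega), LinearMap.rTensor_zero,
      LinearMap.zero_apply]
  | succ m ih =>
    refine lk_induction G (C := fun z => ((l.map G.e).prod).rTensor V z = 0) (by simp)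
      (fun x y hx hy => by rw [map_add, hx, hy, add_zero]) (fun b y hy => ?_) hz
    have := ih (l ++ [b]) (by simp; omega) hy
    rwa [List.map_append, List.prod_append, List.map_singleton, List.prod_singleton,
      Module.End.mul_eq_comp, LinearMap.rTensor_comp] at this

lemma eq_zero_of_mem_lk [Fintype σ] {m : ℕ} (hm : Fintype.card σ < m) {z : G.Λ ⊗[k] V}
    (hz : z ∈ lk G V m) : z = 0 := by
  have := prod_e_lk [] (by simpa using hm) hz
  simpa [Module.End.one_eq_id] using this

lemma i_e_comm (a b : σ) : G.i a * G.e a * G.e b = G.e b * (G.i a * G.e a) ∨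
    G.i a * G.e a * G.e b = 0 := by
  by_cases h : a = b
  · right; rw [h, mul_assoc, G.e_sq, mul_zero]
  · left
    rw [mul_assoc, G.e_anti, mul_neg, ← mul_assoc, G.i_e_ne a b h, neg_mul, neg_neg, mul_assoc]

lemma prod_i_e_mul_e {b : σ} {l : List σ} (h : b ∈ l) :
    (l.map fun a => G.i a * G.e a).prod * G.e b = 0 := by
  induction l with
  | nil => simp at h
  | cons a l ih =>
    rw [List.map_cons, List.prod_cons, mul_assoc]
    by_cases hb : b ∈ l
    · rw [ih hb, mul_zero]
    · have hab : b = a := (List.mem_cons.1 h).resolve_right hb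
      have : ∀ l : List σ, b ∉ l → (l.map fun a => G.i a * G.e a).prod * G.e b =
          G.e b * (l.map fun a => G.i a * G.e a).prod := by
        intro l
        induction l with
        | nil => simp
        | cons c l ih =>
          intro h
          rw [List.mem_cons, not_or] at h
          rw [List.map_cons, List.prod_cons, mul_assoc, ih h.2, ← mul_assoc, mul_assoc (G.i c),
            G.e_anti c b, mul_neg, ← mul_assoc, G.i_e_ne c b (Ne.symm h.1)]
          simp only [neg_mul, neg_neg, mul_assoc]
      rw [this l hb, ← mul_assoc, hab, mul_assoc (G.i a), G.e_sq, mul_zero, zero_mul]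

end Filtration

section Contraction

variable {k : Type} [Field k] {σ : Type} {G : CAR k σ} [Fintype σ]
variable {V : Type} [AddCommGroup V] [Module k V] {X D : σ → Module.End k V}

variable (G) in
lemma koszulD_contract (hD : ∀ a, D a * X a = 1) (hDX : ∀ a b, a ≠ b → D a * X b = X b * D a)
    (a : σ) (z : G.Λ ⊗[k] V) :
    koszulD G X (TensorProduct.map (G.e a) (D a) z) +
      TensorProduct.map (G.e a) (D a) (koszulD G X z) =
      z - TensorProduct.map (G.i a * G.e a) (1 - X a * D a) z := by
  classical
  induction z with
  | zero => simp
  | add x y hx hy => simp only [map_add]; linear_combination (norm := abel) hx + hy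
  | tmul x v =>
    have h1 : ∀ b, G.i b (G.e a x) ⊗ₜ[k] X b (D a v) + G.e a (G.i b x) ⊗ₜ[k] D a (X b v) =
        if b = a then x ⊗ₜ[k] v - G.i a (G.e a x) ⊗ₜ[k] (v - X a (D a v)) else 0 := by
      intro b
      have h2 := LinearMap.congr_fun (G.i_e_same a) x
      have h3 := LinearMap.congr_fun (hD a) v
      simp only [Module.End.mul_apply, LinearMap.sub_apply, Module.End.one_apply] at h2 h3
      split_ifs with hb
      · subst hb
        rw [h3, h2, TensorProduct.sub_tmul, TensorProduct.sub_tmul, TensorProduct.tmul_sub,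
          TensorProduct.tmul_sub]
        abel
      · have h4 := LinearMap.congr_fun (G.i_e_ne b a hb) x
        have h5 := LinearMap.congr_fun (hDX a b (Ne.symm hb)) v
        simp only [Module.End.mul_apply, LinearMap.neg_apply] at h4 h5
        rw [h4, h5, TensorProduct.neg_tmul, neg_add_cancel]
    rw [TensorProduct.map_tmul, koszulD_tmul, koszulD_tmul, map_sum]
    simp only [TensorProduct.map_tmul]
    rw [← Finset.sum_add_distrib, Finset.sum_congr rfl (fun b _ => h1 b), Finset.sum_ite_eq']
    simp

lemma exists_contract (hX : ∀ a b, X a * X b = X b * X a) (hD : ∀ a, D a * X a = 1)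
    (hDX : ∀ a b, a ≠ b → D a * X b = X b * D a) (l : List σ) {m : ℕ} {z : G.Λ ⊗[k] V}
    (hz : z ∈ lk G V m) (hdz : koszulD G X z = 0) :
    ∃ w ∈ lk G V (m + 1), TensorProduct.map (l.map fun a => G.i a * G.e a).prod
      (l.map fun a => 1 - X a * D a).prod z ∈ lk G V m ∧
      koszulD G X w = z - TensorProduct.map (l.map fun a => G.i a * G.e a).prod
      (l.map fun a => 1 - X a * D a).prod z := by
  induction l with
  | nil => exact ⟨0, Submodule.zero_mem _, by simpa using hz, by simp⟩
  | cons a l ih =>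
    obtain ⟨w, hw, hQ, hdw⟩ := ih
    set y := TensorProduct.map (l.map fun a => G.i a * G.e a).prod
      (l.map fun a => 1 - X a * D a).prod z with hy
    have hdy : koszulD G X y = 0 := by
      have := congrArg (koszulD G X) hdw
      rw [koszulD_koszulD G hX, map_sub, hdz, zero_sub] at this
      exact neg_eq_zero.1 this.symm
    have hQy : TensorProduct.map ((a :: l).map fun a => G.i a * G.e a).prod
        ((a :: l).map fun a => 1 - X a * D a).prod z =
        TensorProduct.map (G.i a * G.e a) (1 - X a * D a) y := by
      rw [List.map_cons, List.prod_cons, List.map_cons, List.prod_cons, TensorProduct.map_mul, hy]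
      rfl
    have hc := koszulD_contract G hD hDX a y
    rw [hdy, map_zero, add_zero] at hc
    refine ⟨w + TensorProduct.map (G.e a) (D a) y, Submodule.add_mem _ hw ?_, ?_, ?_⟩
    · have : TensorProduct.map (G.e a) (D a) y =
          (G.e a).rTensor V ((D a).lTensor G.Λ y) := by
        rw [← LinearMap.rTensor_comp_lTensor]
        rfl
      rw [this]
      exact e_mem_lk a (lTensor_mem_lk _ hQ)
    · rw [hQy]
      exact map_mem_lk (i_e_comm a) _ hQ
    · rw [map_add, hdw, hc, hQy]; abel

lemma exists_mem_lk_of_mem_lk (hX : ∀ a b, X a * X b = X b * X a) (hD : ∀ a, D a * X a = 1)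
    (hDX : ∀ a b, a ≠ b → D a * X b = X b * D a) {m : ℕ} {z : G.Λ ⊗[k] V}
    (hz : z ∈ lk G V (m + 1)) (hdz : koszulD G X z = 0) :
    ∃ w ∈ lk G V (m + 2), koszulD G X w = z := by
  obtain ⟨w, hw, -, h⟩ := exists_contract hX hD hDX Finset.univ.toList hz hdz
  refine ⟨w, hw, ?_⟩
  rw [h, sub_eq_self]
  refine lk_induction G (C := fun z => TensorProduct.map _ _ z = 0) (by simp)
    (fun x y hx hy => by rw [map_add, hx, hy, add_zero]) (fun b y _ => ?_) hz
  rw [LinearMap.rTensor, ← LinearMap.comp_apply, ← TensorProduct.map_comp,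
    ← Module.End.mul_eq_comp, prod_i_e_mul_e (by simp), TensorProduct.map_zero_left,
    LinearMap.zero_apply]

end Contraction

section Free

variable {k : Type} [Field k] {σ : Type}

/-- The projection of a polynomial onto its part of degree `t`. -/
noncomputable def hcZ (t : ℤ) : Module.End k (MvPolynomial σ k) :=
  if 0 ≤ t then homogeneousComponent t.toNat else 0

lemma coeff_hcZ (t : ℤ) (p : MvPolynomial σ k) (d : σ →₀ ℕ) :
    coeff d (hcZ t p) = if (d.degree : ℤ) = t then coeff d p else 0 := by
  unfold hcZ
  split_ifs with h1 h2 h2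
  · rw [coeff_homogeneousComponent, if_pos (by omega)]
  · rw [coeff_homogeneousComponent, if_neg (by omega)]
  · omega
  · simp

lemma hcZ_eq_self_iff (t : ℤ) (p : MvPolynomial σ k) : hcZ t p = p ↔ homogZ k p t := by
  unfold hcZ homogZ
  split_ifs with h
  · constructor
    · intro h'
      right
      refine ⟨h, ?_⟩
      rw [← h']
      exact homogeneousComponent_isHomogeneous _ _
    · rintro (rfl | ⟨-, h'⟩)
      · simp
      · rw [homogeneousComponent_of_mem h', if_pos rfl]
  · simp [h, eq_comm]

lemma hcZ_of_neg {t : ℤ} (h : t < 0) : hcZ (k := k) (σ := σ) t = 0 := if_neg (by omega)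

lemma hcZ_X_mul (t : ℤ) (a : σ) (p : MvPolynomial σ k) :
    hcZ (t + 1) (X a * p) = X a * hcZ t p := by
  classical
  ext d
  rw [coeff_hcZ, coeff_X_mul', coeff_X_mul', coeff_hcZ]
  by_cases ha : a ∈ d.support
  · rw [if_pos ha, if_pos ha]
    have : (d - Finsupp.single a 1).degree + 1 = d.degree := by
      have h1 : d - Finsupp.single a 1 + Finsupp.single a 1 = d :=
        tsub_add_cancel_of_le (by
          rw [Finsupp.single_le_iff]
          exact Nat.one_le_iff_ne_zero.2 (Finsupp.mem_support_iff.1 ha))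
      conv_rhs => rw [← h1, map_add, Finsupp.degree_single]
    congr 1
    apply propext
    omega
  · rw [if_neg ha, if_neg ha, ite_self]

/-- The operators on a module given by multiplication with the variables. -/
noncomputable def mulX (k : Type) [Field k] (σ : Type) (M : Type) [AddCommGroup M] [Module k M]
    [Module (MvPolynomial σ k) M] [IsScalarTower k (MvPolynomial σ k) M] (a : σ) :
    Module.End k M :=
  Algebra.lsmul k k M (X a : MvPolynomial σ k)

section
variable {M : Type} [AddCommGroup M] [Module k M]
    [Module (MvPolynomial σ k) M] [IsScalarTower k (MvPolynomial σ k) M]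

lemma mulX_apply (a : σ) (m : M) : mulX k σ M a m = (X a : MvPolynomial σ k) • m := rfl

lemma mulX_comm (a b : σ) : mulX k σ M a * mulX k σ M b = mulX k σ M b * mulX k σ M a := by
  refine LinearMap.ext fun m => ?_
  exact smul_comm (X a : MvPolynomial σ k) (X b : MvPolynomial σ k) m

end

variable {n : ℕ}

/-- The grading of a free module with generators in degrees `tw`. -/
noncomputable def freeGrd (tw : Fin n → ℤ) : Grd (mulX k σ (Fin n → MvPolynomial σ k)) where
  proj e := LinearMap.pi fun l => hcZ (e - tw l) ∘ₗ LinearMap.proj l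
  idem t v := by
    ext l d
    simp only [LinearMap.pi_apply, LinearMap.comp_apply, LinearMap.proj_apply, coeff_hcZ]
    split_ifs <;> rfl
  orth s t v h := by
    ext l d
    simp only [LinearMap.pi_apply, LinearMap.comp_apply, LinearMap.proj_apply, coeff_hcZ,
      Pi.zero_apply, coeff_zero]
    split_ifs <;> first | rfl | omega
  op t a v := by
    funext l
    simp only [LinearMap.pi_apply, LinearMap.comp_apply, LinearMap.proj_apply, mulX_apply,
      Pi.smul_apply, smul_eq_mul]
    rw [← hcZ_X_mul]
    congr 2; ring
  fin v := by
    classical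
    refine ⟨Finset.univ.biUnion fun l => (v l).support.image fun d => (d.degree : ℤ) + tw l, ?_⟩
    ext l d
    rw [Finset.sum_apply, coeff_sum]
    simp only [LinearMap.pi_apply, LinearMap.comp_apply, LinearMap.proj_apply, coeff_hcZ,
      eq_sub_iff_add_eq]
    rw [Finset.sum_ite_eq]
    split_ifs with h
    · rfl
    · by_contra h0
      apply h
      simp only [Finset.mem_biUnion, Finset.mem_image, Finset.mem_univ, true_and]
      exact ⟨l, d, mem_support_iff.2 (Ne.symm h0), rfl⟩

lemma freeGrd_proj (tw : Fin n → ℤ) (e : ℤ) (f : Fin n → MvPolynomial σ k) (l : Fin n) :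
    (freeGrd tw).proj e f l = hcZ (e - tw l) (f l) := rfl

/-- Division by a variable. -/
noncomputable def divX (a : σ) : Module.End k (Fin n → MvPolynomial σ k) where
  toFun f l := divMonomial (f l) (Finsupp.single a 1)
  map_add' f g := by funext l; exact add_divMonomial _ _ _
  map_smul' c f := by
    ext l d
    simp [coeff_divMonomial]

lemma coeff_divX (a : σ) (f : Fin n → MvPolynomial σ k) (l : Fin n) (d : σ →₀ ℕ) :
    coeff d (divX a f l) = coeff (Finsupp.single a 1 + d) (f l) := coeff_divMonomial _ _ _

lemma divX_mulX_same (a : σ) :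
    divX a * mulX k σ (Fin n → MvPolynomial σ k) a = 1 := by
  classical
  refine LinearMap.ext fun f => ?_
  ext l d
  rw [Module.End.mul_apply, coeff_divX, mulX_apply, Pi.smul_apply, smul_eq_mul, coeff_X_mul]
  rfl

lemma divX_mulX_of_ne {a b : σ} (h : a ≠ b) :
    divX a * mulX k σ (Fin n → MvPolynomial σ k) b = mulX k σ _ b * divX a := by
  classical
  refine LinearMap.ext fun f => ?_
  ext l d
  rw [Module.End.mul_apply, Module.End.mul_apply, coeff_divX, mulX_apply, mulX_apply,
    Pi.smul_apply, Pi.smul_apply, smul_eq_mul, smul_eq_mul, coeff_X_mul', coeff_X_mul', coeff_divX]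
  have h1 : b ∈ (Finsupp.single a 1 + d).support ↔ b ∈ d.support := by
    simp [Finsupp.single_eq_of_ne (Ne.symm h)]
  simp only [h1]
  split_ifs with hb
  · congr 1
    refine add_tsub_assoc_of_le ?_ _
    rw [Finsupp.single_le_iff]
    exact Nat.one_le_iff_ne_zero.2 (Finsupp.mem_support_iff.1 hb)
  · rfl

lemma coeff_one_sub_mulX_divX (a : σ) (f : Fin n → MvPolynomial σ k) (l : Fin n) (d : σ →₀ ℕ) :
    coeff d ((1 - mulX k σ _ a * divX a : Module.End k _) f l) =
      if d a = 0 then coeff d (f l) else 0 := by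
  classical
  rw [LinearMap.sub_apply, Module.End.mul_apply, mulX_apply, Pi.sub_apply, coeff_sub,
    Pi.smul_apply, smul_eq_mul, coeff_X_mul', Module.End.one_apply, coeff_divX]
  by_cases hd : d a = 0
  · simp [hd]
  · rw [if_pos (Finsupp.mem_support_iff.2 hd), if_neg hd, add_tsub_cancel_of_le, sub_self]
    rw [Finsupp.single_le_iff]
    exact Nat.one_le_iff_ne_zero.2 hd

lemma coeff_prod_one_sub_mulX_divX (s : List σ) (f : Fin n → MvPolynomial σ k) (l : Fin n)
    (d : σ →₀ ℕ) :
    coeff d ((s.map fun a => (1 - mulX k σ _ a * divX a : Module.End k _)).prod f l) =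
      if ∀ a ∈ s, d a = 0 then coeff d (f l) else 0 := by
  classical
  induction s with
  | nil => simp
  | cons a s ih =>
    rw [List.map_cons, List.prod_cons, Module.End.mul_apply, coeff_one_sub_mulX_divX, ih]
    simp only [List.forall_mem_cons, ite_and]

/-- The constant coefficients of the coordinates. -/
noncomputable def constCoords (k σ : Type) [Field k] (n : ℕ) :
    (Fin n → MvPolynomial σ k) →ₗ[k] (Fin n → k) :=
  LinearMap.pi fun l => (lcoeff k (0 : σ →₀ ℕ)) ∘ₗ LinearMap.proj l

lemma constCoords_apply (f : Fin n → MvPolynomial σ k) (l : Fin n) :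
    constCoords k σ n f l = coeff 0 (f l) := rfl

variable [Fintype σ] (G : CAR k σ)

lemma free_exists_mem_lk {m : ℕ} {z : G.Λ ⊗[k] (Fin n → MvPolynomial σ k)}
    (hz : z ∈ lk G _ (m + 1)) (hdz : koszulD G (mulX k σ _) z = 0) :
    ∃ w ∈ lk G _ (m + 2), koszulD G (mulX k σ _) w = z :=
  exists_mem_lk_of_mem_lk mulX_comm divX_mulX_same (fun _ _ h => divX_mulX_of_ne h) hz hdz

lemma free_exists_of_constCoords {z : G.Λ ⊗[k] (Fin n → MvPolynomial σ k)}
    (hz : (constCoords k σ n).lTensor G.Λ z = 0) (hdz : koszulD G (mulX k σ _) z = 0) :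
    ∃ w ∈ lk G _ 1, koszulD G (mulX k σ _) w = z := by
  classical
  obtain ⟨w, hw, -, h⟩ := exists_contract (m := 0) mulX_comm divX_mulX_same
    (fun _ _ h => divX_mulX_of_ne h) Finset.univ.toList (Submodule.mem_top (x := z)) hdz
  refine ⟨w, hw, ?_⟩
  rw [h, sub_eq_self]
  have : (Finset.univ.toList.map fun a : σ => (1 - mulX k σ _ a * divX a : Module.End k _)).prod =
      (LinearMap.pi fun l => (Algebra.linearMap k (MvPolynomial σ k)) ∘ₗ LinearMap.proj l) ∘ₗ
        constCoords k σ n := by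
    refine LinearMap.ext fun f => ?_
    ext l d
    rw [coeff_prod_one_sub_mulX_divX]
    simp only [LinearMap.comp_apply, LinearMap.pi_apply, LinearMap.proj_apply,
      Algebra.linearMap_apply, algebraMap_eq, coeff_C, constCoords_apply, Finset.mem_toList,
      Finset.mem_univ, true_imp_iff]
    by_cases hd : d = 0
    · simp [hd]
    · rw [if_neg (Ne.symm hd), if_neg]
      intro h
      exact hd (Finsupp.ext h)
  rw [this, ← LinearMap.comp_id (List.prod _), TensorProduct.map_comp, LinearMap.comp_apply]
  rw [LinearMap.lTensor] at hz
  rw [hz, map_zero]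

lemma freeGrd_regLE (tw : Fin n → ℤ) {r : ℤ} (h : ∀ l, tw l ≤ r) :
    (freeGrd (k := k) (σ := σ) tw).RegLE G r := by
  intro t ht z hz hdz
  have h0 : constCoords k σ n ∘ₗ (freeGrd tw).proj t = 0 := by
    refine LinearMap.ext fun f => funext fun l => ?_
    have := h l
    rw [LinearMap.comp_apply, constCoords_apply, freeGrd_proj, coeff_hcZ, if_neg]
    · rfl
    · simp; omega
  obtain ⟨w, -, hw⟩ := free_exists_of_constCoords G (z := z) (by
    rw [← hz, Grd.kproj, ← LinearMap.comp_apply, ← LinearMap.lTensor_comp, h0,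
      LinearMap.lTensor_zero, LinearMap.zero_apply]) hdz
  exact ⟨w, hw⟩

end Free

section ExactSequence

variable {k : Type} [Field k] {σ : Type} {G : CAR k σ}
variable {U V W : Type} [AddCommGroup U] [Module k U] [AddCommGroup V] [Module k V]
  [AddCommGroup W] [Module k W]
variable {XU : σ → Module.End k U} {XV : σ → Module.End k V} {XW : σ → Module.End k W}
variable {ι : U →ₗ[k] V} {φ : V →ₗ[k] W}

variable {gU : Grd XU} {gV : Grd XV} {gW : Grd XW}

lemma kproj_lTensor {t : ℤ} (h : ∀ v, φ (gV.proj t v) = gW.proj t (φ v)) (z : G.Λ ⊗[k] V) :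
    gW.kproj G t (φ.lTensor G.Λ z) = φ.lTensor G.Λ (gV.kproj G t z) := by
  have : φ ∘ₗ gV.proj t = gW.proj t ∘ₗ φ := LinearMap.ext h
  rw [Grd.kproj, Grd.kproj, ← LinearMap.comp_apply, ← LinearMap.comp_apply,
    ← LinearMap.lTensor_comp, ← LinearMap.lTensor_comp, this]

variable [Fintype σ]

lemma exists_koszulD_eq_of_lift (hι : Function.Injective ι) (hφ : Function.Surjective φ)
    (hex : Function.Exact ι φ) (hXι : ∀ a v, ι (XU a v) = XV a (ι v))
    (hXφ : ∀ a v, φ (XV a v) = XW a (φ v)) (hX : ∀ a b, XV a * XV b = XV b * XV a)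
    {z : G.Λ ⊗[k] U} {w : G.Λ ⊗[k] V} {u : G.Λ ⊗[k] W} (hw : koszulD G XV w = ι.lTensor G.Λ z)
    (hu : koszulD G XW u = φ.lTensor G.Λ w) : ∃ y, koszulD G XU y = z := by
  obtain ⟨u', rfl⟩ := LinearMap.lTensor_surjective G.Λ hφ u
  rw [koszulD_lTensor G φ hXφ] at hu
  obtain ⟨y, hy⟩ := (lTensor_exact G.Λ hex hφ (w - koszulD G XV u')).1 (by
    rw [map_sub, hu, sub_self])
  refine ⟨y, Module.Flat.lTensor_preserves_injective_linearMap (M := G.Λ) ι hι ?_⟩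
  rw [← koszulD_lTensor G ι hXι, hy, map_sub, koszulD_koszulD G hX, hw, sub_zero]

lemma Grd.RegLE.of_exact_left (hι : Function.Injective ι) (hφ : Function.Surjective φ)
    (hex : Function.Exact ι φ) (hXι : ∀ a v, ι (XU a v) = XV a (ι v))
    (hXφ : ∀ a v, φ (XV a v) = XW a (φ v)) (hX : ∀ a b, XV a * XV b = XV b * XV a)
    (hpι : ∀ t v, ι (gU.proj t v) = gV.proj t (ι v))
    (hpφ : ∀ t v, φ (gV.proj t v) = gW.proj t (φ v)) {r : ℤ} (hV : gV.RegLE G r)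
    (hW : gW.RegLE G r) : gU.RegLE G (r + 1) := by
  intro t ht z hz hdz
  obtain ⟨w, hw, hdw⟩ := hV.exists_kproj (t := t) (z := ι.lTensor G.Λ z) (by omega)
    (by rw [kproj_lTensor (hpι t), hz]) (by rw [koszulD_lTensor G ι hXι, hdz, map_zero])
  obtain ⟨u, hu⟩ := hW (t - 1) (by omega) (φ.lTensor G.Λ w)
    (by rw [kproj_lTensor (hpφ _), hw]) (by
      rw [koszulD_lTensor G φ hXφ, hdw]
      exact (lTensor_exact G.Λ hex hφ _).2 ⟨z, rfl⟩)
  exact exists_koszulD_eq_of_lift hι hφ hex hXι hXφ hX hdw hu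

lemma Grd.RegLE.of_exact_right (hι : Function.Injective ι) (hφ : Function.Surjective φ)
    (hex : Function.Exact ι φ) (hXι : ∀ a v, ι (XU a v) = XV a (ι v))
    (hXφ : ∀ a v, φ (XV a v) = XW a (φ v)) (hX : ∀ a b, XV a * XV b = XV b * XV a)
    (hpι : ∀ t v, ι (gU.proj t v) = gV.proj t (ι v))
    (hpφ : ∀ t v, φ (gV.proj t v) = gW.proj t (φ v)) {r : ℤ} (hU : gU.RegLE G (r + 1))
    (hV : gV.RegLE G r) : gW.RegLE G r := by
  have hinj := Module.Flat.lTensor_preserves_injective_linearMap (M := G.Λ) ι hι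
  intro t ht z hz hdz
  obtain ⟨y, hy⟩ := LinearMap.lTensor_surjective G.Λ hφ z
  obtain ⟨z', hz', hz'p⟩ : ∃ z', φ.lTensor G.Λ z' = z ∧ gV.kproj G t z' = z' :=
    ⟨gV.kproj G t y, by rw [← kproj_lTensor (hpφ t), hy, hz], gV.kproj_idem _ _⟩
  obtain ⟨x, hx⟩ := (lTensor_exact G.Λ hex hφ (koszulD G XV z')).1 (by
    rw [← koszulD_lTensor G φ hXφ, hz', hdz])
  obtain ⟨x', hx'p, hx'⟩ := hU.exists_kproj (t := t + 1) (z := x) (by omega)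
    (hinj (by rw [← kproj_lTensor (hpι _), hx, gV.kproj_koszulD, hz'p]))
    (hinj (by rw [← koszulD_lTensor G ι hXι, hx, koszulD_koszulD G hX, map_zero]))
  rw [add_sub_cancel_right] at hx'p
  obtain ⟨w, hw⟩ := hV t ht (z' - ι.lTensor G.Λ x')
    (by rw [map_sub, hz'p, kproj_lTensor (hpι _), hx'p])
    (by rw [map_sub, koszulD_lTensor G ι hXι, hx', hx, sub_self])
  refine ⟨φ.lTensor G.Λ w, ?_⟩
  rw [koszulD_lTensor G φ hXφ, hw, map_sub, hz',
    (lTensor_exact G.Λ hex hφ (ι.lTensor G.Λ x')).2 ⟨x', rfl⟩, sub_zero]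

end ExactSequence

lemma linearMap_apply_eq_sum_single {R M : Type} [CommRing R] [AddCommGroup M] [Module R M] {n : ℕ}
    (φ : (Fin n → R) →ₗ[R] M) (f : Fin n → R) : φ f = ∑ l, f l • φ (Pi.single l 1) := by
  conv_lhs => rw [pi_eq_sum_univ' f]
  rw [map_sum]
  exact Finset.sum_congr rfl fun l _ => map_smul _ _ _

section GradedModule

variable {k : Type} [Field k] {σ : Type}
variable {M : Type} [AddCommGroup M] [Module k M]
  [Module (MvPolynomial σ k) M] [IsScalarTower k (MvPolynomial σ k) M]
variable (g : Grd (mulX k σ M))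

lemma Grd.proj_of_ne {s t : ℤ} (h : s ≠ t) {m : M} (hm : g.proj t m = m) : g.proj s m = 0 := by
  rw [← hm, g.orth s t m h]

lemma Grd.proj_smul {t : ℤ} {m : M} (hm : g.proj t m = m) (e : ℤ) (p : MvPolynomial σ k) :
    g.proj e (p • m) = hcZ (e - t) p • m := by
  induction p using MvPolynomial.induction_on generalizing e with
  | C c =>
    have h1 : hcZ (e - t) (C c : MvPolynomial σ k) = if e = t then C c else 0 := by
      classical
      ext d
      rw [coeff_hcZ]
      by_cases hd : d = 0
      · subst hd
        by_cases het : e = t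
        · simp [het]
        · rw [if_neg, if_neg het]
          · rfl
          · simp; omega
      · rw [coeff_C, if_neg (Ne.symm hd), ite_self]
        split_ifs
        · rw [coeff_C, if_neg (Ne.symm hd)]
        · rfl
    have h2 : ∀ m : M, (C c : MvPolynomial σ k) • m = c • m := fun m => by
      rw [← algebraMap_eq, algebraMap_smul]
    rw [h1, h2, map_smul]
    split_ifs with h
    · rw [h, hm, h2]
    · rw [g.proj_of_ne h hm, smul_zero, zero_smul]
  | add p q hp hq => rw [add_smul, map_add, hp, hq, map_add, add_smul]
  | mul_X p a hp =>
    rw [mul_comm, mul_smul, ← mulX_apply]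
    have h1 := g.op (e - 1) a (p • m)
    have h2 := hcZ_X_mul (e - 1 - t) a p
    rw [sub_add_cancel] at h1
    rw [show e - 1 - t + 1 = e - t by ring] at h2
    rw [h1, hp, h2, mulX_apply, mul_smul]

/-- The homogeneous elements of degree `t`. -/
def Grd.gr (t : ℤ) : AddSubgroup M := (LinearMap.eqLocus (g.proj t) LinearMap.id).toAddSubgroup

lemma Grd.mem_gr {t : ℤ} {m : M} : m ∈ g.gr t ↔ g.proj t m = m := Iff.rfl

/-- The grading of a homogeneous submodule. -/
def Grd.sub (Z : Submodule (MvPolynomial σ k) M) (h : ∀ t, ∀ z ∈ Z, g.proj t z ∈ Z) :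
    Grd (mulX k σ Z) where
  proj t :=
    { toFun := fun z => ⟨g.proj t z, h t z z.2⟩
      map_add' := fun x y => Subtype.ext (map_add _ _ _)
      map_smul' := fun c x => Subtype.ext (map_smul _ c (x : M)) }
  idem t v := Subtype.ext (g.idem t v)
  orth s t v hst := Subtype.ext (g.orth s t v hst)
  op t a v := Subtype.ext (g.op t a v)
  fin v := by
    obtain ⟨s, hs⟩ := g.fin v
    refine ⟨s, Subtype.ext ?_⟩
    rw [AddSubmonoidClass.coe_finsetSum]
    exact hs

lemma Grd.proj_freeGrd {n : ℕ} {tw : Fin n → ℤ}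
    {φ : (Fin n → MvPolynomial σ k) →ₗ[MvPolynomial σ k] M}
    (hφ : ∀ l, g.proj (tw l) (φ (Pi.single l 1)) = φ (Pi.single l 1)) (e : ℤ)
    (f : Fin n → MvPolynomial σ k) : φ ((freeGrd tw).proj e f) = g.proj e (φ f) := by
  have h1 : ∀ f, φ f = ∑ l, f l • φ (Pi.single l 1) := fun f => by
    conv_lhs => rw [pi_eq_sum_univ' f]
    rw [map_sum]
    refine Finset.sum_congr rfl fun l _ => ?_
    rw [map_smul]
  rw [h1, h1, map_sum]
  exact Finset.sum_congr rfl fun l _ => by rw [g.proj_smul (hφ l), freeGrd_proj]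

variable [Fintype σ] {G : CAR k σ}

theorem GradedFreeRes.regLE (F : GradedFreeRes k σ M g.gr) {r : ℤ}
    (hr : ∀ i (l : Fin (F.rk i)), F.tw i l - (i : ℤ) ≤ r) : g.RegLE G r := by
  have hd : ∀ i e f, F.d i ((freeGrd (F.tw (i + 1))).proj e f) =
      (freeGrd (F.tw i)).proj e (F.d i f) := fun i =>
    Grd.proj_freeGrd (freeGrd (F.tw i)) fun l => by
      funext l'
      rw [freeGrd_proj, hcZ_eq_self_iff]
      exact F.d_homog i l l'
  have hstab : ∀ i t, ∀ z ∈ LinearMap.range (F.d i), (freeGrd (F.tw i)).proj t z ∈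
      LinearMap.range (F.d i) := by
    rintro i t _ ⟨f, rfl⟩
    exact ⟨_, hd i t f⟩
  have hfree : ∀ i, (freeGrd (k := k) (σ := σ) (F.tw i)).RegLE G (r + i) := fun i =>
    freeGrd_regLE G _ fun l => by have := hr i l; omega
  obtain ⟨N, hN⟩ := F.bdd
  have hZ : ∀ j i, N ≤ i + j → ((freeGrd (F.tw i)).sub _ (hstab i)).RegLE G (r + i + 1) := by
    intro j
    induction j with
    | zero =>
      intro i hi t ht z hz hdz
      have : IsEmpty (Fin (F.rk i)) := by rw [hN i hi]; infer_instance
      have h1 : Subsingleton (LinearMap.range (F.d i)) :=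
        ⟨fun x y => Subtype.ext (Subsingleton.elim _ _)⟩
      have h2 : Subsingleton (G.Λ ⊗[k] LinearMap.range (F.d i)) := inferInstance
      exact ⟨0, Subsingleton.elim _ _⟩
    | succ j ih =>
      intro i hi
      have h1 := ih (i + 1) (by omega)
      have h2 := hfree (i + 1)
      push_cast at h1 h2
      rw [← add_assoc] at h1 h2
      refine Grd.RegLE.of_exact_right
        (gW := (freeGrd (F.tw i)).sub _ (hstab i))
        (gU := (freeGrd (F.tw (i + 1))).sub _ (hstab (i + 1))) (gV := freeGrd (F.tw (i + 1)))
        (ι := (LinearMap.range (F.d (i + 1))).subtype.restrictScalars k)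
        (φ := (F.d i).rangeRestrict.restrictScalars k) (Submodule.subtype_injective _)
        (F.d i).surjective_rangeRestrict ?_ (fun a v => rfl)
        (fun a v => map_smul (F.d i).rangeRestrict _ _) mulX_comm (fun t v => rfl)
        (fun t v => Subtype.ext (hd i t v)) h1 h2
      intro f
      change (F.d i).rangeRestrict f = 0 ↔ f ∈ Set.range (Subtype.val)
      rw [Subtype.range_coe, SetLike.mem_coe, F.exact_succ, LinearMap.mem_ker, Subtype.ext_iff]
      rfl
  have h1 := hZ N 0 (by omega)
  have h2 := hfree 0
  rw [Nat.cast_zero, add_zero] at h1 h2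
  refine Grd.RegLE.of_exact_right (ι := (LinearMap.range (F.d 0)).subtype.restrictScalars k)
    (φ := F.aug.restrictScalars k) (Submodule.subtype_injective _) F.aug_surj ?_ (fun a v => rfl)
    (fun a v => map_smul F.aug _ _) mulX_comm (fun t v => rfl)
    (fun t v => g.proj_freeGrd F.aug_homog t v) h1 h2
  intro f
  change F.aug f = 0 ↔ f ∈ Set.range (Subtype.val)
  rw [Subtype.range_coe, SetLike.mem_coe, F.exact_zero, LinearMap.mem_ker]

end GradedModule

section MinimalCover

variable {k : Type} [Field k] {σ : Type}
variable {M : Type} [AddCommGroup M] [Module k M]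
  [Module (MvPolynomial σ k) M] [IsScalarTower k (MvPolynomial σ k) M]
variable (g : Grd (mulX k σ M))

/-- A surjection from a free graded module of rank `n`. -/
def Grd.HasCover (n : ℕ) : Prop :=
  ∃ (tw : Fin n → ℤ) (φ : (Fin n → MvPolynomial σ k) →ₗ[MvPolynomial σ k] M),
    Function.Surjective φ ∧ ∀ l, g.proj (tw l) (φ (Pi.single l 1)) = φ (Pi.single l 1)

lemma Grd.hasCover_of_span {n : ℕ} {tw : Fin n → ℤ} {m : Fin n → M}
    (hm : ∀ l, g.proj (tw l) (m l) = m l)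
    (hs : Submodule.span (MvPolynomial σ k) (Set.range m) = ⊤) : g.HasCover n := by
  refine ⟨tw, Fintype.linearCombination _ m, ?_, fun l => ?_⟩
  · rw [← LinearMap.range_eq_top, Fintype.range_linearCombination, hs]
  · rw [Fintype.linearCombination_apply_single, one_smul, hm]

lemma Grd.exists_hasCover [hM : Module.Finite (MvPolynomial σ k) M] : ∃ n, g.HasCover n := by
  classical
  obtain ⟨S, hS⟩ := hM.fg_top
  choose s hs using g.fin
  let T : Finset (Σ _ : M, ℤ) := S.sigma s
  let E := T.equivFin.symm
  refine ⟨T.card, g.hasCover_of_span (tw := fun l => (E l).1.2)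
    (m := fun l => g.proj (E l).1.2 (E l).1.1) (fun l => g.idem _ _) ?_⟩
  rw [eq_top_iff, ← hS, Submodule.span_le]
  intro x hx
  rw [SetLike.mem_coe, ← hs x]
  refine Submodule.sum_mem _ fun t ht => Submodule.subset_span ?_
  exact ⟨E.symm ⟨⟨x, t⟩, Finset.mem_sigma.2 ⟨hx, ht⟩⟩, by simp⟩

lemma Grd.exists_minimal_cover [Module.Finite (MvPolynomial σ k) M] :
    ∃ (n : ℕ) (tw : Fin n → ℤ) (φ : (Fin n → MvPolynomial σ k) →ₗ[MvPolynomial σ k] M),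
      Function.Surjective φ ∧ (∀ l, g.proj (tw l) (φ (Pi.single l 1)) = φ (Pi.single l 1)) ∧
      ∀ f, φ f = 0 → constCoords k σ n f = 0 := by
  classical
  have hex := g.exists_hasCover
  obtain ⟨tw, φ, hφ, hh⟩ := Nat.find_spec hex
  refine ⟨_, tw, φ, hφ, hh, fun f hf => funext fun l => ?_⟩
  by_contra hl
  have hmin : ∀ m < Nat.find hex, ¬ g.HasCover m := fun m hm => Nat.find_min hex hm
  generalize Nat.find hex = n at *
  obtain _ | n := n
  · exact l.elim0
  refine hmin n (Nat.lt_succ_self n) (g.hasCover_of_span (tw := fun j => tw (l.succAbove j))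
    (m := fun j => φ (Pi.single (l.succAbove j) 1)) (fun j => hh _) ?_)
  set N := Submodule.span (MvPolynomial σ k)
    (Set.range fun j => φ (Pi.single (l.succAbove j) 1)) with hN
  have h1 : ∀ j, φ (Pi.single (l.succAbove j) 1) ∈ N := fun j => Submodule.subset_span ⟨j, rfl⟩
  have h2 : φ (Pi.single l 1) ∈ N := by
    have h3 : φ ((freeGrd tw).proj (tw l) f) = 0 := by rw [g.proj_freeGrd hh, hf, map_zero]
    rw [linearMap_apply_eq_sum_single, Fin.sum_univ_succAbove _ l, freeGrd_proj, sub_self] at h3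
    have h4 : hcZ 0 (f l) = C (coeff 0 (f l)) := by
      ext d
      rw [coeff_hcZ, coeff_C]
      by_cases hd : d = 0
      · subst hd; simp
      · rw [if_neg, if_neg (Ne.symm hd)]
        rwa [Nat.cast_eq_zero, Finsupp.degree_eq_zero_iff]
    rw [h4] at h3
    have h5 : (C (coeff 0 (f l)) : MvPolynomial σ k) • φ (Pi.single l 1) ∈ N := by
      rw [eq_neg_of_add_eq_zero_left h3]
      exact N.neg_mem (N.sum_mem fun j _ => N.smul_mem _ (h1 j))
    have h6 := N.smul_mem (C (coeff 0 (f l))⁻¹) h5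
    have h7 : coeff 0 (f l) ≠ 0 := hl
    rwa [smul_smul, ← C_mul, inv_mul_cancel₀ h7, C_1, one_smul] at h6
  rw [eq_top_iff]
  rintro x -
  obtain ⟨f, rfl⟩ := hφ x
  rw [linearMap_apply_eq_sum_single, Fin.sum_univ_succAbove _ l]
  exact N.add_mem (N.smul_mem _ h2) (N.sum_mem fun j _ => N.smul_mem _ (h1 j))

lemma Grd.eq_zero_of_nakayama {B : ℤ} (hB : ∀ t < B, g.proj t = 0)
    (h : ∀ m : M, ∃ (s : Finset σ) (u : σ → M), m = ∑ a ∈ s, (X a : MvPolynomial σ k) • u a)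
    (m : M) : m = 0 := by
  have h0 : ∀ (N : ℕ) (t : ℤ), t < B + N → ∀ m, g.proj t m = 0 := by
    intro N
    induction N with
    | zero =>
      intro t ht m
      rw [hB t (by simpa using ht)]; rfl
    | succ N ih =>
      intro t ht m
      obtain ⟨s, u, rfl⟩ := h m
      rw [map_sum]
      refine Finset.sum_eq_zero fun a _ => ?_
      have := g.op (t - 1) a (u a)
      rw [sub_add_cancel, ih (t - 1) (by push_cast at ht; omega), map_zero] at this
      exact this
  obtain ⟨s, hs⟩ := g.fin m
  rw [← hs]
  exact Finset.sum_eq_zero fun t _ => h0 (t - B + 1).toNat t (by omega) m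

variable [Fintype σ] {G : CAR k σ}

lemma exists_ev_koszulD (w : G.Λ ⊗[k] M) : ∃ u : σ → M,
    TensorProduct.lid k M (G.ev.rTensor M (koszulD G (mulX k σ M) w)) =
      ∑ a, (X a : MvPolynomial σ k) • u a := by
  refine ⟨fun a => TensorProduct.lid k M ((G.ev ∘ₗ G.i a).rTensor M w), ?_⟩
  induction w with
  | zero => simp
  | add x y hx hy => simp only [map_add, hx, hy, smul_add, Finset.sum_add_distrib]
  | tmul x m =>
    rw [koszulD_tmul, map_sum, map_sum]
    refine Finset.sum_congr rfl fun a _ => ?_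
    simp only [LinearMap.rTensor_tmul, TensorProduct.lid_tmul, LinearMap.comp_apply]
    rw [← map_smul]
    rfl

lemma exists_of_koszulD_eq_vac {w : G.Λ ⊗[k] M} {m : M}
    (h : koszulD G (mulX k σ M) w = G.vac ⊗ₜ m) :
    ∃ u : σ → M, m = ∑ a, (X a : MvPolynomial σ k) • u a := by
  obtain ⟨u, hu⟩ := exists_ev_koszulD w
  refine ⟨u, ?_⟩
  rw [← hu, h]
  simp [G.ev_vac]

lemma koszulD_vac (m : M) : koszulD G (mulX k σ M) (G.vac ⊗ₜ m) = 0 := by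
  simp [koszulD_tmul, G.i_vac]

lemma constCoords_sum_X_smul {n : ℕ} (q : σ → Fin n → MvPolynomial σ k) :
    constCoords k σ n (∑ a, (X a : MvPolynomial σ k) • q a) = 0 := by
  classical
  funext l
  rw [constCoords_apply, Finset.sum_apply, coeff_sum]
  refine Finset.sum_eq_zero fun a _ => ?_
  rw [Pi.smul_apply, smul_eq_mul, coeff_X_mul']
  simp

variable {g}

lemma Grd.RegLE.tw_le {r : ℤ} (h : g.RegLE G r) {n : ℕ} {tw : Fin n → ℤ}
    {φ : (Fin n → MvPolynomial σ k) →ₗ[MvPolynomial σ k] M}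
    (hφ : Function.Surjective φ) (hh : ∀ l, g.proj (tw l) (φ (Pi.single l 1)) = φ (Pi.single l 1))
    (hmin : ∀ f, φ f = 0 → constCoords k σ n f = 0) (l : Fin n) : tw l ≤ r := by
  by_contra! hl
  obtain ⟨w, hw⟩ := h (tw l) hl (G.vac ⊗ₜ φ (Pi.single l 1))
    (by rw [g.kproj_tmul, hh]) (koszulD_vac _)
  obtain ⟨u, hu⟩ := exists_of_koszulD_eq_vac hw
  choose q hq using fun a => hφ (u a)
  have h1 := hmin (Pi.single l 1 - ∑ a, (X a : MvPolynomial σ k) • q a) (by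
    rw [map_sub, map_sum, hu, sub_eq_zero]
    exact Finset.sum_congr rfl fun a _ => by rw [map_smul, hq])
  rw [map_sub, constCoords_sum_X_smul, sub_zero] at h1
  have h2 := congrFun h1 l
  rw [constCoords_apply] at h2
  simp at h2

end MinimalCover

section MinimalResolution

variable {k : Type} [Field k] {σ : Type}

/-- The zero resolution. -/
noncomputable def GradedFreeRes.zero (M : Type) [AddCommGroup M] [Module (MvPolynomial σ k) M]
    (gr : ℤ → AddSubgroup M) (hM : ∀ m : M, m = 0) : GradedFreeRes k σ M gr where
  rk _ := 0
  tw _ l := l.elim0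
  bdd := ⟨0, fun _ _ => rfl⟩
  aug := 0
  d _ := 0
  aug_surj m := ⟨0, (hM m).symm⟩
  exact_zero := by ext f; simp [Subsingleton.elim f 0]
  exact_succ i := by ext f; simp [Subsingleton.elim f 0]
  aug_homog l := l.elim0
  d_homog _ l := l.elim0

/-- A resolution obtained from a surjection from a free module and a resolution of its kernel. -/
noncomputable def GradedFreeRes.splice {M : Type} [AddCommGroup M] [Module (MvPolynomial σ k) M]
    {gr : ℤ → AddSubgroup M} {n : ℕ} (tw : Fin n → ℤ)
    (φ : (Fin n → MvPolynomial σ k) →ₗ[MvPolynomial σ k] M)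
    (hφ : Function.Surjective φ) (hh : ∀ l, φ (Pi.single l 1) ∈ gr (tw l))
    {gr' : ℤ → AddSubgroup (LinearMap.ker φ)}
    (hgr : ∀ t, ∀ z ∈ gr' t, ∀ l, homogZ k ((z : Fin n → MvPolynomial σ k) l) (t - tw l))
    (F : GradedFreeRes k σ (LinearMap.ker φ) gr') : GradedFreeRes k σ M gr where
  rk i := match i with
    | 0 => n
    | i + 1 => F.rk i
  tw i := match i with
    | 0 => tw
    | i + 1 => F.tw i
  bdd := by
    obtain ⟨N, hN⟩ := F.bdd
    refine ⟨N + 1, fun i hi => ?_⟩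
    obtain _ | i := i
    · omega
    · exact hN i (by omega)
  aug := φ
  d i := match i with
    | 0 => (LinearMap.ker φ).subtype ∘ₗ F.aug
    | i + 1 => F.d i
  aug_surj := hφ
  exact_zero := by
    change LinearMap.range ((LinearMap.ker φ).subtype ∘ₗ F.aug) = _
    rw [LinearMap.range_comp, LinearMap.range_eq_top.2 F.aug_surj, Submodule.map_top,
      Submodule.range_subtype]
  exact_succ i := by
    obtain _ | i := i
    · change LinearMap.range (F.d 0) = LinearMap.ker ((LinearMap.ker φ).subtype ∘ₗ F.aug)
      rw [F.exact_zero, LinearMap.ker_comp, Submodule.ker_subtype]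
      rfl
    · exact F.exact_succ i
  aug_homog := hh
  d_homog i := by
    obtain _ | i := i
    · exact fun l l' => hgr _ _ (F.aug_homog l) l'
    · exact F.d_homog i

lemma exact_ker_subtype {M : Type} [AddCommGroup M] [Module k M] [Module (MvPolynomial σ k) M]
    [IsScalarTower k (MvPolynomial σ k) M] {n : ℕ}
    {φ : (Fin n → MvPolynomial σ k) →ₗ[MvPolynomial σ k] M} :
    Function.Exact ((LinearMap.ker φ).subtype.restrictScalars k) (φ.restrictScalars k) := by
  intro f
  change φ f = 0 ↔ f ∈ Set.range Subtype.val
  rw [Subtype.range_coe, SetLike.mem_coe, LinearMap.mem_ker]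

variable [Fintype σ] (G : CAR k σ)

/-- Exactness of the Koszul complex in exterior degrees at least `m`. -/
def LkExact (M : Type) [AddCommGroup M] [Module k M] [Module (MvPolynomial σ k) M]
    [IsScalarTower k (MvPolynomial σ k) M] (m : ℕ) : Prop :=
  ∀ z ∈ lk G M m, koszulD G (mulX k σ M) z = 0 → ∃ w, koszulD G (mulX k σ M) w = z

section Cover

variable {G}
variable {M : Type} [AddCommGroup M] [Module k M] [Module (MvPolynomial σ k) M]
  [IsScalarTower k (MvPolynomial σ k) M] {g : Grd (mulX k σ M)} {n : ℕ} {tw : Fin n → ℤ}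
  {φ : (Fin n → MvPolynomial σ k) →ₗ[MvPolynomial σ k] M}

/-- The grading of the kernel of a graded surjection from a free module. -/
noncomputable def kerGrd (hh : ∀ l, g.proj (tw l) (φ (Pi.single l 1)) = φ (Pi.single l 1)) :
    Grd (mulX k σ (LinearMap.ker φ)) :=
  (freeGrd tw).sub (LinearMap.ker φ) fun t z hz => by
    rw [LinearMap.mem_ker] at hz ⊢
    rw [g.proj_freeGrd hh, hz, map_zero]

lemma exists_koszulD_eq_of_ker (hφ : Function.Surjective φ) {z : G.Λ ⊗[k] LinearMap.ker φ}
    {w : G.Λ ⊗[k] (Fin n → MvPolynomial σ k)} {u : G.Λ ⊗[k] M}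
    (hw : koszulD G (mulX k σ _) w =
      ((LinearMap.ker φ).subtype.restrictScalars k).lTensor G.Λ z)
    (hu : koszulD G (mulX k σ _) u = (φ.restrictScalars k).lTensor G.Λ w) :
    ∃ y, koszulD G (mulX k σ (LinearMap.ker φ)) y = z :=
  exists_koszulD_eq_of_lift (ι := (LinearMap.ker φ).subtype.restrictScalars k)
    (φ := φ.restrictScalars k) (XV := mulX k σ _) (Submodule.subtype_injective _) hφ
    exact_ker_subtype (fun _ _ => rfl) (fun _ _ => map_smul φ _ _) mulX_comm hw hu

lemma koszulD_lTensor_ker (w : G.Λ ⊗[k] (Fin n → MvPolynomial σ k)) :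
    koszulD G (mulX k σ M) ((φ.restrictScalars k).lTensor G.Λ w) =
      (φ.restrictScalars k).lTensor G.Λ (koszulD G (mulX k σ _) w) :=
  koszulD_lTensor G _ (fun _ _ => map_smul φ _ _) w

lemma lkExact_ker (hφ : Function.Surjective φ) {m : ℕ} (h : LkExact G M (m + 2)) :
    LkExact G (LinearMap.ker φ) (m + 1) := by
  intro z hz hdz
  obtain ⟨w, hw, hdw⟩ := free_exists_mem_lk G
    (lTensor_mem_lk ((LinearMap.ker φ).subtype.restrictScalars k) hz)
    (by rw [koszulD_lTensor (X := mulX k σ _) G _ (fun _ _ => rfl), hdz, map_zero])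
  obtain ⟨u, hu⟩ := h _ (lTensor_mem_lk (φ.restrictScalars k) hw)
    (by rw [koszulD_lTensor_ker, hdw]
        exact (lTensor_exact G.Λ exact_ker_subtype hφ _).2 ⟨z, rfl⟩)
  exact exists_koszulD_eq_of_ker hφ hdw hu

lemma ker_eq_zero (hφ : Function.Surjective φ)
    (hh : ∀ l, g.proj (tw l) (φ (Pi.single l 1)) = φ (Pi.single l 1))
    (hmin : ∀ f, φ f = 0 → constCoords k σ n f = 0) (h : LkExact G M 1) (z : LinearMap.ker φ) :
    z = 0 := by
  obtain ⟨B, hB⟩ : ∃ B, ∀ l, B ≤ tw l := by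
    obtain ⟨B, hB⟩ := (Set.finite_range tw).bddBelow
    exact ⟨B, fun l => hB ⟨l, rfl⟩⟩
  refine (kerGrd hh).eq_zero_of_nakayama (B := B) (fun t ht => ?_) (fun z => ?_) z
  · refine LinearMap.ext fun z => Subtype.ext ?_
    funext l
    change hcZ (t - tw l) _ = 0
    rw [hcZ_of_neg (by have := hB l; omega)]
    rfl
  · obtain ⟨w, hw, hdw⟩ := free_exists_of_constCoords G
      (z := G.vac ⊗ₜ[k] (z : Fin n → MvPolynomial σ k))
      (by rw [LinearMap.lTensor_tmul, hmin _ z.2, TensorProduct.tmul_zero]) (koszulD_vac _)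
    obtain ⟨u, hu⟩ := h _ (lTensor_mem_lk (φ.restrictScalars k) hw) (by
      rw [koszulD_lTensor_ker, hdw, LinearMap.lTensor_tmul]
      exact (congrArg _ z.2).trans (TensorProduct.tmul_zero _ _))
    obtain ⟨y, hy⟩ := exists_koszulD_eq_of_ker (z := G.vac ⊗ₜ z) hφ hdw hu
    obtain ⟨u, hu⟩ := exists_of_koszulD_eq_vac hy
    exact ⟨Finset.univ, u, hu⟩

lemma exists_splice (hφ : Function.Surjective φ)
    (hh : ∀ l, g.proj (tw l) (φ (Pi.single l 1)) = φ (Pi.single l 1))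
    (hmin : ∀ f, φ f = 0 → constCoords k σ n f = 0)
    (h : ∃ F : GradedFreeRes k σ (LinearMap.ker φ) (kerGrd hh).gr,
      ∀ r, (kerGrd hh).RegLE G r → ∀ i l, F.tw i l - (i : ℤ) ≤ r) :
    ∃ F : GradedFreeRes k σ M g.gr, ∀ r, g.RegLE G r → ∀ i l, F.tw i l - (i : ℤ) ≤ r := by
  obtain ⟨F, hF⟩ := h
  refine ⟨F.splice tw φ hφ hh fun t z hz l => ?_, fun r hr i => ?_⟩
  · rw [← hcZ_eq_self_iff]
    exact congrFun (congrArg Subtype.val hz) l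
  · have htw := hr.tw_le hφ hh hmin
    have hZ : (kerGrd hh).RegLE G (r + 1) :=
      Grd.RegLE.of_exact_left (ι := (LinearMap.ker φ).subtype.restrictScalars k)
        (φ := φ.restrictScalars k) (gU := kerGrd hh) (gV := freeGrd tw) (gW := g)
        (Submodule.subtype_injective _) hφ
        exact_ker_subtype (fun _ _ => rfl) (fun _ _ => map_smul φ _ _) mulX_comm (fun _ _ => rfl)
        (fun t v => g.proj_freeGrd hh t v) (freeGrd_regLE G tw htw) hr
    obtain _ | i := i
    · intro l
      change tw l - ((0 : ℕ) : ℤ) ≤ r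
      simpa using htw l
    · intro l
      have h1 : F.tw i l - (i : ℤ) ≤ r + 1 := hF (r + 1) hZ i l
      change F.tw i l - ((i + 1 : ℕ) : ℤ) ≤ r
      push_cast
      omega

end Cover

theorem exists_gradedFreeRes_of_lkExact (N : ℕ) : ∀ (M : Type) [AddCommGroup M] [Module k M]
    [Module (MvPolynomial σ k) M] [IsScalarTower k (MvPolynomial σ k) M]
    [Module.Finite (MvPolynomial σ k) M] (g : Grd (mulX k σ M)), LkExact G M (N + 1) →
    ∃ F : GradedFreeRes k σ M g.gr, ∀ r, g.RegLE G r → ∀ i l, F.tw i l - (i : ℤ) ≤ r := by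
  induction N with
  | zero =>
    intro M _ _ _ _ _ g h
    obtain ⟨n, tw, φ, hφ, hh, hmin⟩ := g.exists_minimal_cover
    exact exists_splice hφ hh hmin ⟨GradedFreeRes.zero _ _ (ker_eq_zero hφ hh hmin h),
      fun _ _ _ l => l.elim0⟩
  | succ N ih =>
    intro M _ _ _ _ _ g h
    obtain ⟨n, tw, φ, hφ, hh, hmin⟩ := g.exists_minimal_cover
    exact exists_splice hφ hh hmin (ih (LinearMap.ker φ) (kerGrd hh) (lkExact_ker hφ h))

theorem exists_gradedFreeRes {M : Type} [AddCommGroup M] [Module k M]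
    [Module (MvPolynomial σ k) M] [IsScalarTower k (MvPolynomial σ k) M]
    [Module.Finite (MvPolynomial σ k) M] (g : Grd (mulX k σ M)) :
    ∃ F : GradedFreeRes k σ M g.gr, ∀ r, g.RegLE G r → ∀ i l, F.tw i l - (i : ℤ) ≤ r :=
  exists_gradedFreeRes_of_lkExact G (Fintype.card σ) M g fun z hz _ =>
    ⟨0, by rw [eq_zero_of_mem_lk (Nat.lt_succ_self _) hz, map_zero]⟩

theorem regM_eq {M : Type} [AddCommGroup M] [Module k M]
    [Module (MvPolynomial σ k) M] [IsScalarTower k (MvPolynomial σ k) M]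
    [Module.Finite (MvPolynomial σ k) M] (g : Grd (mulX k σ M)) :
    regM k σ M g.gr = sInf {r | g.RegLE G r} := by
  unfold regM
  congr 1
  ext r
  constructor
  · rintro ⟨F, hF⟩
    exact F.regLE g hF
  · intro h
    obtain ⟨F, hF⟩ := exists_gradedFreeRes G g
    exact ⟨F, hF r h⟩

end MinimalResolution

section HomogeneousIdeals

variable {k : Type} [Field k] {σ τ : Type}

section
attribute [local instance] MvPolynomial.gradedAlgebra

lemma isHomogeneousIdeal_iff {I : Ideal (MvPolynomial σ k)} :
    IsHomogeneousIdeal k I ↔ I.IsHomogeneous (homogeneousSubmodule σ k) := by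
  constructor
  · intro h i f hf
    have := h f hf i
    rwa [← decomposition.decompose'_apply] at this
  · exact fun h f hf m => homogeneousComponent_mem_of_mem h hf m

lemma IsHomogeneousIdeal.mul {I J : Ideal (MvPolynomial σ k)} (hI : IsHomogeneousIdeal k I)
    (hJ : IsHomogeneousIdeal k J) : IsHomogeneousIdeal k (I * J) := by
  rw [isHomogeneousIdeal_iff] at *
  exact hI.mul hJ

lemma IsHomogeneousIdeal.pow {I : Ideal (MvPolynomial σ k)} (hI : IsHomogeneousIdeal k I) (n : ℕ) :
    IsHomogeneousIdeal k (I ^ n) := by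
  induction n with
  | zero => exact fun f _ m => by simp
  | succ n ih => rw [pow_succ]; exact ih.mul hI

lemma IsHomogeneousIdeal.sup {I J : Ideal (MvPolynomial σ k)} (hI : IsHomogeneousIdeal k I)
    (hJ : IsHomogeneousIdeal k J) : IsHomogeneousIdeal k (I ⊔ J) := by
  rw [isHomogeneousIdeal_iff] at *
  exact hI.sup hJ

lemma IsHomogeneousIdeal.map_rename {I : Ideal (MvPolynomial σ k)} (hI : IsHomogeneousIdeal k I)
    (f : σ → τ) : IsHomogeneousIdeal k (I.map (rename f : MvPolynomial σ k →ₐ[k] _)) := by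
  have h : I.map (rename f : MvPolynomial σ k →ₐ[k] MvPolynomial τ k) =
      Ideal.span (rename f '' {p | p ∈ I ∧ ∃ n, p.IsHomogeneous n}) := by
    refine le_antisymm (Ideal.map_le_iff_le_comap.2 fun p hp => ?_) (Ideal.span_mono ?_)
    · rw [Ideal.mem_comap, ← sum_homogeneousComponent p, map_sum]
      exact Ideal.sum_mem _ fun n _ => Ideal.subset_span
        ⟨_, ⟨hI p hp n, n, homogeneousComponent_isHomogeneous _ _⟩, rfl⟩
    · exact Set.image_mono fun p hp => hp.1
  rw [h, isHomogeneousIdeal_iff]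
  refine Ideal.homogeneous_span _ _ ?_
  rintro _ ⟨p, ⟨-, n, hn⟩, rfl⟩
  exact ⟨n, hn.rename_isHomogeneous⟩

end

lemma IsHomogeneousIdeal.hcZ_mem {I : Ideal (MvPolynomial σ k)} (hI : IsHomogeneousIdeal k I)
    (t : ℤ) {f : MvPolynomial σ k} (hf : f ∈ I) : hcZ t f ∈ I := by
  unfold hcZ
  split_ifs
  · exact hI f hf _
  · exact I.zero_mem

lemma hcZ_hcZ (t : ℤ) (p : MvPolynomial σ k) : hcZ t (hcZ t p) = hcZ t p := by
  ext d
  simp only [coeff_hcZ]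
  split_ifs <;> rfl

lemma hcZ_hcZ_of_ne {s t : ℤ} (h : s ≠ t) (p : MvPolynomial σ k) : hcZ s (hcZ t p) = 0 := by
  ext d
  simp only [coeff_hcZ, coeff_zero]
  split_ifs with h1 h2
  · exact absurd (h1.symm.trans h2) h
  · rfl
  · rfl

lemma exists_sum_hcZ (p : MvPolynomial σ k) : ∃ s : Finset ℤ, ∑ t ∈ s, hcZ t p = p := by
  refine ⟨(Finset.range (p.totalDegree + 1)).map Nat.castEmbedding, ?_⟩
  rw [Finset.sum_map]
  conv_rhs => rw [← sum_homogeneousComponent p]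
  exact Finset.sum_congr rfl fun n _ => by simp [hcZ]

end HomogeneousIdeals

section SubQuot

variable {k : Type} [Field k] {σ : Type} {p q : Ideal (MvPolynomial σ k)}

/-- The class in `p/q` of an element of `p`, as a linear map over `k`. -/
noncomputable def sqMk (p q : Ideal (MvPolynomial σ k)) : p →ₗ[k] subQuot k p q :=
  (Submodule.mkQ (Submodule.comap p.subtype q)).restrictScalars k

lemma sqMk_surjective : Function.Surjective (sqMk p q) := by
  rintro ⟨f⟩
  exact ⟨f, rfl⟩

lemma sqMk_eq_zero_iff (f : p) : sqMk p q f = 0 ↔ (f : MvPolynomial σ k) ∈ q :=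
  Submodule.Quotient.mk_eq_zero _

lemma smul_sqMk (c : MvPolynomial σ k) (f : p) : c • sqMk p q f = sqMk p q (c • f) := rfl

/-- The projection of a homogeneous ideal onto its part of degree `t`. -/
noncomputable def idealProj (hp : IsHomogeneousIdeal k p) (t : ℤ) : Module.End k p :=
  (hcZ t).restrict (p := p.restrictScalars k) (q := p.restrictScalars k) fun _ h => hp.hcZ_mem t h

lemma coe_idealProj (hp : IsHomogeneousIdeal k p) (t : ℤ) (f : p) :
    (idealProj hp t f : MvPolynomial σ k) = hcZ t f := rfl

/-- The projection of `p/q` onto its part of degree `t`. -/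
noncomputable def sqProj (hp : IsHomogeneousIdeal k p) (hq : IsHomogeneousIdeal k q) (t : ℤ) :
    Module.End k (subQuot k p q) :=
  let N := Submodule.comap p.subtype q
  (Submodule.Quotient.restrictScalarsEquiv k N).toLinearMap ∘ₗ
    Submodule.mapQ (N.restrictScalars k) (N.restrictScalars k) (idealProj hp t)
      (fun _ h => hq.hcZ_mem t h) ∘ₗ (Submodule.Quotient.restrictScalarsEquiv k N).symm.toLinearMap

lemma sqProj_sqMk (hp : IsHomogeneousIdeal k p) (hq : IsHomogeneousIdeal k q) (t : ℤ) (f : p) :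
    sqProj hp hq t (sqMk p q f) = sqMk p q (idealProj hp t f) := rfl

/-- The grading of `p/q`. -/
noncomputable def sqGrd (hp : IsHomogeneousIdeal k p) (hq : IsHomogeneousIdeal k q) :
    Grd (mulX k σ (subQuot k p q)) where
  proj := sqProj hp hq
  idem t v := by
    obtain ⟨f, rfl⟩ := sqMk_surjective v
    rw [sqProj_sqMk, sqProj_sqMk]
    exact congrArg _ (Subtype.ext (hcZ_hcZ t _))
  orth s t v h := by
    obtain ⟨f, rfl⟩ := sqMk_surjective v
    rw [sqProj_sqMk, sqProj_sqMk, sqMk_eq_zero_iff, coe_idealProj, coe_idealProj,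
      hcZ_hcZ_of_ne h]
    exact q.zero_mem
  op t a v := by
    obtain ⟨f, rfl⟩ := sqMk_surjective v
    rw [mulX_apply, mulX_apply, smul_sqMk, sqProj_sqMk, sqProj_sqMk, smul_sqMk]
    exact congrArg _ (Subtype.ext (hcZ_X_mul t a _))
  fin v := by
    obtain ⟨f, rfl⟩ := sqMk_surjective v
    obtain ⟨s, hs⟩ := exists_sum_hcZ (f : MvPolynomial σ k)
    refine ⟨s, ?_⟩
    simp_rw [sqProj_sqMk]
    rw [← map_sum]
    refine congrArg _ (Subtype.ext ?_)
    rw [AddSubmonoidClass.coe_finsetSum]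
    exact hs

lemma sqGrd_proj (hp : IsHomogeneousIdeal k p) (hq : IsHomogeneousIdeal k q) (t : ℤ) (f : p) :
    (sqGrd hp hq).proj t (sqMk p q f) = sqMk p q (idealProj hp t f) := rfl

lemma sqGrd_proj_of_neg (hp : IsHomogeneousIdeal k p) (hq : IsHomogeneousIdeal k q) {t : ℤ}
    (ht : t < 0) : (sqGrd hp hq).proj t = 0 := by
  refine LinearMap.ext fun v => ?_
  obtain ⟨f, rfl⟩ := sqMk_surjective v
  rw [sqGrd_proj, LinearMap.zero_apply, sqMk_eq_zero_iff, coe_idealProj, hcZ_of_neg ht]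
  exact q.zero_mem

lemma subQuotGr_eq (hp : IsHomogeneousIdeal k p) (hq : IsHomogeneousIdeal k q) :
    subQuotGr k p q = (sqGrd hp hq).gr := by
  funext t
  refine le_antisymm ((AddSubgroup.closure_le _).2 ?_) fun v hv => ?_
  · rintro _ ⟨f, hf, rfl⟩
    change (sqGrd hp hq).proj t (sqMk p q f) = sqMk p q f
    rw [sqGrd_proj]
    exact congrArg _ (Subtype.ext ((hcZ_eq_self_iff t _).2 hf))
  · obtain ⟨f, rfl⟩ := sqMk_surjective v
    refine AddSubgroup.subset_closure ⟨idealProj hp t f, ?_, ?_⟩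
    · rw [← hcZ_eq_self_iff, coe_idealProj, hcZ_hcZ]
    · exact (Grd.mem_gr _).1 hv |>.symm

lemma regSubQuot_eq [Fintype σ] (G : CAR k σ) (hp : IsHomogeneousIdeal k p)
    (hq : IsHomogeneousIdeal k q) :
    regSubQuot k p q = sInf {r | (sqGrd hp hq).RegLE G r} := by
  rw [regSubQuot, subQuotGr_eq hp hq, regM_eq G]

end SubQuot

section Section

variable {k : Type} [Field k] {σ : Type} (p q : Ideal (MvPolynomial σ k))

lemma exists_sqSec : ∃ f : subQuot k p q →ₗ[k] p, sqMk p q ∘ₗ f = LinearMap.id :=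
  LinearMap.exists_rightInverse_of_surjective _ (LinearMap.range_eq_top.2 sqMk_surjective)

/-- A section of the projection `p → p/q`, linear over `k`. -/
noncomputable def sqSec : subQuot k p q →ₗ[k] p := (exists_sqSec p q).choose

variable {p q}

lemma sqMk_sqSec (x : subQuot k p q) : sqMk p q (sqSec p q x) = x :=
  LinearMap.congr_fun (exists_sqSec p q).choose_spec x

lemma sqSec_sqMk_sub_mem (f : p) : ((sqSec p q (sqMk p q f) - f : p) : MvPolynomial σ k) ∈ q := by
  rw [← sqMk_eq_zero_iff, map_sub, sqMk_sqSec, sub_self]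

end Section

section SumDecomposition

variable {k : Type} [Field k] {r s : ℕ}

lemma hcZ_rename {σ τ : Type} (f : σ → τ) (t : ℤ) (p : MvPolynomial σ k) :
    hcZ t (rename f p) = rename f (hcZ t p) := by
  unfold hcZ
  split_ifs
  · exact (rename_homogeneousComponent _ _).symm
  · simp

variable {I : Ideal (PA k r)} {J : Ideal (PB k s)}

lemma rename_inl_mem {m : ℕ} {f : PA k r} (hf : f ∈ I ^ m) :
    (rename Sum.inl f : PR k r s) ∈ extA k (s := s) I ^ m := by
  rw [extA, ← Ideal.map_pow]
  exact Ideal.mem_map_of_mem _ hf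

lemma rename_inr_mem {m : ℕ} {f : PB k s} (hf : f ∈ J ^ m) :
    (rename Sum.inr f : PR k r s) ∈ extB k (r := r) J ^ m := by
  rw [extB, ← Ideal.map_pow]
  exact Ideal.mem_map_of_mem _ hf

lemma rename_mul_mem {m j n : ℕ} (h : m + j = n) {f : PA k r} {g : PB k s} (hf : f ∈ I ^ m)
    (hg : g ∈ J ^ j) : (rename Sum.inl f * rename Sum.inr g : PR k r s) ∈ sumIJ k I J ^ n := by
  rw [← h, pow_add]
  exact Ideal.mul_mem_mul (Ideal.pow_right_mono le_sup_left _ (rename_inl_mem hf))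
    (Ideal.pow_right_mono le_sup_right _ (rename_inr_mem hg))

lemma sumIJ_pow_le {n : ℕ} {P : Ideal (PR k r s)}
    (h : ∀ m j, m + j = n → ∀ f ∈ I ^ m, ∀ g ∈ J ^ j, rename Sum.inl f * rename Sum.inr g ∈ P) :
    sumIJ k I J ^ n ≤ P := by
  rw [sumIJ, add_pow, Ideal.sum_eq_sup]
  refine Finset.sup_le fun m hm => Ideal.mul_le_left.trans ?_
  have hm' := Finset.mem_range.1 hm
  rw [extA, extB, ← Ideal.map_pow, ← Ideal.map_pow, Ideal.map, Ideal.map, Ideal.span_mul_span',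
    Ideal.span_le]
  rintro _ ⟨_, ⟨f, hf, rfl⟩, _, ⟨g, hg, rfl⟩, rfl⟩
  exact h m (n - m) (by omega) f hf g hg

lemma IsHomogeneousIdeal.sumIJ (hI : IsHomogeneousIdeal k I) (hJ : IsHomogeneousIdeal k J) :
    IsHomogeneousIdeal k (sumIJ k I J) :=
  (hI.map_rename _).sup (hJ.map_rename _)

variable (I J)

/-- The multiplication map `I^m ⊗ J^j → (I+J)^n`. -/
noncomputable def powMul {m j n : ℕ} (h : m + j = n) :
    ↥(I ^ m) ⊗[k] ↥(J ^ j) →ₗ[k] ↥(sumIJ k I J ^ n) :=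
  TensorProduct.lift (LinearMap.mk₂ k
    (fun f g => ⟨rename Sum.inl (f : PA k r) * rename Sum.inr (g : PB k s),
      rename_mul_mem h f.2 g.2⟩)
    (fun _ _ _ => Subtype.ext (by simp [add_mul]))
    (fun _ _ _ => Subtype.ext (by simp))
    (fun _ _ _ => Subtype.ext (by simp [mul_add]))
    (fun _ _ _ => Subtype.ext (by simp)))

lemma coe_powMul_tmul {m j n : ℕ} (h : m + j = n) (f : ↥(I ^ m)) (g : ↥(J ^ j)) :
    (powMul I J h (f ⊗ₜ g) : PR k r s) =
      rename Sum.inl (f : PA k r) * rename Sum.inr (g : PB k s) :=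
  rfl

/-- A `k`-linear lift of the multiplication map on the subquotients. -/
noncomputable def psiLift {m j n : ℕ} (h : m + j = n) :
    subQuot k (I ^ m) (I ^ (m + 1)) ⊗[k] subQuot k (J ^ j) (J ^ (j + 1)) →ₗ[k]
      ↥(sumIJ k I J ^ n) :=
  powMul I J h ∘ₗ TensorProduct.map (sqSec _ _) (sqSec _ _)

/-- The multiplication map on the subquotients. -/
noncomputable def psi {m j n : ℕ} (h : m + j = n) :
    subQuot k (I ^ m) (I ^ (m + 1)) ⊗[k] subQuot k (J ^ j) (J ^ (j + 1)) →ₗ[k]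
      subQuot k (sumIJ k I J ^ n) (sumIJ k I J ^ (n + 1)) :=
  sqMk _ _ ∘ₗ psiLift I J h

variable {I J}

lemma psi_tmul {m j n : ℕ} (h : m + j = n) (f : ↥(I ^ m)) (g : ↥(J ^ j)) :
    psi I J h (sqMk _ _ f ⊗ₜ sqMk _ _ g) = sqMk _ _ (powMul I J h (f ⊗ₜ g)) := by
  set f' := sqSec _ _ (sqMk (I ^ m) (I ^ (m + 1)) f) with hf'
  set g' := sqSec _ _ (sqMk (J ^ j) (J ^ (j + 1)) g) with hg'
  have hf : ((f' - f : ↥(I ^ m)) : PA k r) ∈ I ^ (m + 1) := sqSec_sqMk_sub_mem f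
  have hg : ((g' - g : ↥(J ^ j)) : PB k s) ∈ J ^ (j + 1) := sqSec_sqMk_sub_mem g
  change sqMk _ _ (powMul I J h (f' ⊗ₜ g')) = _
  rw [← sub_eq_zero, ← map_sub, sqMk_eq_zero_iff]
  have : powMul I J h (f' ⊗ₜ g') - powMul I J h (f ⊗ₜ g) =
      powMul I J h ((f' - f) ⊗ₜ g') + powMul I J h (f ⊗ₜ (g' - g)) := by
    rw [← map_sub, ← map_add, TensorProduct.sub_tmul, TensorProduct.tmul_sub]
    congr 1
    abel
  rw [this, Submodule.coe_add, coe_powMul_tmul, coe_powMul_tmul]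
  exact Ideal.add_mem _ (rename_mul_mem (by omega) hf g'.2) (rename_mul_mem (by omega) f.2 hg)

lemma subQuot_tensor_induction {m j : ℕ}
    {C : subQuot k (I ^ m) (I ^ (m + 1)) ⊗[k] subQuot k (J ^ j) (J ^ (j + 1)) → Prop}
    (h0 : C 0) (ha : ∀ x y, C x → C y → C (x + y))
    (ht : ∀ f g, C (sqMk _ _ f ⊗ₜ sqMk _ _ g)) (x) : C x := by
  induction x with
  | zero => exact h0
  | add x y hx hy => exact ha x y hx hy
  | tmul x y =>
    obtain ⟨f, rfl⟩ := sqMk_surjective x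
    obtain ⟨g, rfl⟩ := sqMk_surjective y
    exact ht f g

lemma psi_prodOp {m j n : ℕ} (h : m + j = n) (a : Fin r ⊕ Fin s) (x) :
    psi I J h (prodOp (mulX k (Fin r) _) (mulX k (Fin s) _) a x) =
      mulX k (Fin r ⊕ Fin s) _ a (psi I J h x) := by
  induction x using subQuot_tensor_induction with
  | h0 => simp only [map_zero]
  | ha x y hx hy => simp only [map_add, hx, hy]
  | ht f g =>
  obtain a | a := a
  · change psi I J h (sqMk _ _ ((X a : PA k r) • f) ⊗ₜ sqMk _ _ g) = _
    rw [psi_tmul, psi_tmul, mulX_apply, smul_sqMk]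
    refine congrArg _ (Subtype.ext ?_)
    rw [coe_powMul_tmul, Submodule.coe_smul, Submodule.coe_smul, coe_powMul_tmul]
    simp [mul_assoc]
  · change psi I J h (sqMk _ _ f ⊗ₜ sqMk _ _ ((X a : PB k s) • g)) = _
    rw [psi_tmul, psi_tmul, mulX_apply, smul_sqMk]
    refine congrArg _ (Subtype.ext ?_)
    rw [coe_powMul_tmul, Submodule.coe_smul, Submodule.coe_smul, coe_powMul_tmul]
    simp [mul_left_comm]

end SumDecomposition

section Separation

variable {k : Type} [Field k]

/-- The inclusion of `p/q` into the quotient by `q`, linear over `k`. -/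
noncomputable def sqIncl {σ : Type} (p q : Ideal (MvPolynomial σ k)) :
    subQuot k p q →ₗ[k] MvPolynomial σ k ⧸ q :=
  (Ideal.Quotient.mkₐ k q).toLinearMap ∘ₗ p.subtype.restrictScalars k ∘ₗ sqSec p q

lemma sqIncl_injective {σ : Type} (p q : Ideal (MvPolynomial σ k)) :
    Function.Injective (sqIncl p q) := by
  rw [injective_iff_map_eq_zero]
  intro x hx
  rw [← sqMk_sqSec x, sqMk_eq_zero_iff]
  exact Ideal.Quotient.eq_zero_iff_mem.1 hx

variable {r s : ℕ} (I : Ideal (PA k r)) (J : Ideal (PB k s))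

/-- The map `R → A/I^(m+1) ⊗ B/J^(j+1)`. -/
noncomputable def sepMap (m j : ℕ) :
    PR k r s →ₐ[k] (PA k r ⧸ I ^ (m + 1)) ⊗[k] (PB k s ⧸ J ^ (j + 1)) :=
  aeval (R := k) (S₁ := (PA k r ⧸ I ^ (m + 1)) ⊗[k] (PB k s ⧸ J ^ (j + 1)))
    (Sum.elim (fun a => Ideal.Quotient.mk _ (X a) ⊗ₜ 1) fun b => 1 ⊗ₜ Ideal.Quotient.mk _ (X b))

variable {I J}

lemma sepMap_rename_inl (m j : ℕ) (f : PA k r) :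
    sepMap I J m j (rename Sum.inl f) = Ideal.Quotient.mk _ f ⊗ₜ 1 := by
  have : (sepMap I J m j).comp (rename Sum.inl) =
      Algebra.TensorProduct.includeLeft.comp (Ideal.Quotient.mkₐ k _) := by
    ext a
    simp [sepMap]
  exact DFunLike.congr_fun this f

lemma sepMap_rename_inr (m j : ℕ) (g : PB k s) :
    sepMap I J m j (rename Sum.inr g) = 1 ⊗ₜ Ideal.Quotient.mk _ g := by
  have : (sepMap I J m j).comp (rename Sum.inr) =
      Algebra.TensorProduct.includeRight.comp (Ideal.Quotient.mkₐ k _) := by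
    ext a
    simp [sepMap]
  exact DFunLike.congr_fun this g

lemma sepMap_mul (m j : ℕ) (f : PA k r) (g : PB k s) :
    sepMap I J m j (rename Sum.inl f * rename Sum.inr g) =
      Ideal.Quotient.mk _ f ⊗ₜ Ideal.Quotient.mk _ g := by
  rw [map_mul, sepMap_rename_inl, sepMap_rename_inr, Algebra.TensorProduct.tmul_mul_tmul, mul_one,
    one_mul]

lemma sepMap_mul_eq_zero {m j m' j' : ℕ} (h : m < m' ∨ j < j') {f : PA k r} {g : PB k s}
    (hf : f ∈ I ^ m') (hg : g ∈ J ^ j') :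
    sepMap I J m j (rename Sum.inl f * rename Sum.inr g) = 0 := by
  rw [sepMap_mul]
  obtain h | h := h
  · rw [Ideal.Quotient.eq_zero_iff_mem.2 (Ideal.pow_le_pow_right h hf), TensorProduct.zero_tmul]
  · rw [Ideal.Quotient.eq_zero_iff_mem.2 (Ideal.pow_le_pow_right h hg), TensorProduct.tmul_zero]

lemma sepMap_eq_zero_of_mem {m j n : ℕ} (h : m + j = n) {x : PR k r s}
    (hx : x ∈ sumIJ k I J ^ (n + 1)) : sepMap I J m j x = 0 := by
  have : sumIJ k I J ^ (n + 1) ≤ RingHom.ker (sepMap I J m j) :=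
    sumIJ_pow_le fun m' j' h' f hf g hg => sepMap_mul_eq_zero (by omega) hf hg
  exact this hx

lemma sepMap_psiLift_of_ne {m j m' j' n : ℕ} (h : m + j = n) (h' : m' + j' = n) (hm : m ≠ m')
    (x : subQuot k (I ^ m') (I ^ (m' + 1)) ⊗[k] subQuot k (J ^ j') (J ^ (j' + 1))) :
    sepMap I J m j (psiLift I J h' x) = 0 := by
  induction x with
  | zero => simp only [map_zero, ZeroMemClass.coe_zero]
  | add x y hx hy => rw [map_add, Submodule.coe_add, map_add, hx, hy, add_zero]
  | tmul x y => exact sepMap_mul_eq_zero (by omega) (sqSec _ _ x).2 (sqSec _ _ y).2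

lemma sepMap_psiLift {m j n : ℕ} (h : m + j = n)
    (x : subQuot k (I ^ m) (I ^ (m + 1)) ⊗[k] subQuot k (J ^ j) (J ^ (j + 1))) :
    sepMap I J m j (psiLift I J h x) = TensorProduct.map (sqIncl _ _) (sqIncl _ _) x := by
  induction x with
  | zero => simp only [map_zero, ZeroMemClass.coe_zero]
  | add x y hx hy => rw [map_add, Submodule.coe_add, map_add, hx, hy, map_add]
  | tmul x y => exact sepMap_mul m j _ _

variable (I J)

/-- The product of the spaces `I^m/I^(m+1) ⊗ J^(n-m)/J^(n-m+1)`. -/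
abbrev PowTensor (n : ℕ) : Type :=
  (m : Fin (n + 1)) → subQuot k (I ^ (m : ℕ)) (I ^ ((m : ℕ) + 1)) ⊗[k]
    subQuot k (J ^ (n - m)) (J ^ (n - m + 1))

/-- The sum of the multiplication maps. -/
noncomputable def psiSum (n : ℕ) :
    PowTensor I J n →ₗ[k] subQuot k (sumIJ k I J ^ n) (sumIJ k I J ^ (n + 1)) :=
  ∑ m, psi I J (Nat.add_sub_cancel' (Nat.le_of_lt_succ m.2)) ∘ₗ LinearMap.proj m

variable {I J}

lemma psiSum_apply (n : ℕ) (x) : psiSum I J n x =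
    ∑ m, psi I J (Nat.add_sub_cancel' (Nat.le_of_lt_succ m.2)) (x m) := by
  simp [psiSum]

lemma psiSum_single (n : ℕ) (m : Fin (n + 1)) (x) : psiSum I J n (Pi.single m x) =
    psi I J (Nat.add_sub_cancel' (Nat.le_of_lt_succ m.2)) x := by
  rw [psiSum_apply, Finset.sum_eq_single m, Pi.single_eq_same]
  · intro b _ hb
    rw [Pi.single_eq_of_ne hb, map_zero]
  · simp

lemma psiSum_injective (n : ℕ) : Function.Injective (psiSum I J n) := by
  intro x y hxy
  have h (m : Fin (n + 1)) : (m : ℕ) + (n - m) = n := Nat.add_sub_cancel' (Nat.le_of_lt_succ m.2)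
  have h1 (x : PowTensor I J n) : psiSum I J n x = sqMk _ _ (∑ m, psiLift I J (h m) (x m)) := by
    rw [psiSum_apply, map_sum]; rfl
  have h2 (x : PowTensor I J n) (m : Fin (n + 1)) : sepMap I J m (n - m)
      (∑ j, psiLift I J (h j) (x j) : ↥(sumIJ k I J ^ n)) =
        TensorProduct.map (sqIncl _ _) (sqIncl _ _) (x m) := by
    rw [AddSubmonoidClass.coe_finsetSum, map_sum, Finset.sum_eq_single m, sepMap_psiLift]
    · exact fun b _ hb => sepMap_psiLift_of_ne (h m) (h b) (fun e => hb (Fin.ext e.symm)) _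
    · simp
  rw [h1, h1, ← sub_eq_zero, ← map_sub, sqMk_eq_zero_iff] at hxy
  funext m
  have h3 := sepMap_eq_zero_of_mem (h m) hxy
  rw [Submodule.coe_sub, map_sub, h2, h2, sub_eq_zero] at h3
  exact TensorProduct.map_injective_of_flat_flat _ _ (sqIncl_injective _ _)
    (sqIncl_injective _ _) h3

lemma smul_mem_range_psiSum (n : ℕ) (c : PR k r s)
    {y : subQuot k (sumIJ k I J ^ n) (sumIJ k I J ^ (n + 1))}
    (hy : y ∈ LinearMap.range (psiSum I J n)) : c • y ∈ LinearMap.range (psiSum I J n) := by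
  induction c using MvPolynomial.induction_on with
  | C c =>
    have : (C c : PR k r s) • y = c • y := by
      rw [← algebraMap_eq, algebraMap_smul]
    rw [this]
    exact Submodule.smul_mem _ _ hy
  | add p q hp hq => rw [add_smul]; exact Submodule.add_mem _ hp hq
  | mul_X p a hp =>
    obtain ⟨x, hx⟩ := hp
    refine ⟨fun m => prodOp (mulX k (Fin r) _) (mulX k (Fin s) _) a (x m), ?_⟩
    rw [mul_comm, mul_smul, ← hx, psiSum_apply, psiSum_apply, Finset.smul_sum]
    exact Finset.sum_congr rfl fun m _ => psi_prodOp _ a _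

lemma psiSum_surjective (n : ℕ) : Function.Surjective (psiSum I J n) := by
  intro y
  obtain ⟨⟨y, hy⟩, rfl⟩ := sqMk_surjective y
  let S : Submodule (PR k r s) (subQuot k (sumIJ k I J ^ n) (sumIJ k I J ^ (n + 1))) :=
    { (LinearMap.range (psiSum I J n)).toAddSubmonoid with
      smul_mem' := fun c _ hy => smul_mem_range_psiSum n c hy }
  let T : Ideal (PR k r s) := (S.comap (Submodule.mkQ _)).map (sumIJ k I J ^ n).subtype
  have hT : sumIJ k I J ^ n ≤ T := by
    refine sumIJ_pow_le fun m j h f hf g hg => ?_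
    refine ⟨⟨_, rename_mul_mem h hf hg⟩, ?_, rfl⟩
    obtain rfl : j = n - m := by omega
    exact ⟨Pi.single ⟨m, by omega⟩ (sqMk _ _ ⟨f, hf⟩ ⊗ₜ sqMk _ _ ⟨g, hg⟩), by
      rw [psiSum_single, psi_tmul]; rfl⟩
  obtain ⟨⟨z, hz'⟩, hz, rfl⟩ := hT hy
  exact hz

variable (I J) in
/-- The decomposition of the subquotient of powers of `I + J`. -/
noncomputable def psiEquiv (n : ℕ) :
    PowTensor I J n ≃ₗ[k] subQuot k (sumIJ k I J ^ n) (sumIJ k I J ^ (n + 1)) :=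
  LinearEquiv.ofBijective (psiSum I J n) ⟨psiSum_injective n, psiSum_surjective n⟩

variable (I J) in
/-- The projections onto the pieces of the decomposition. -/
noncomputable def psiProj (n : ℕ) (m : Fin (n + 1)) :
    subQuot k (sumIJ k I J ^ n) (sumIJ k I J ^ (n + 1)) →ₗ[k]
      subQuot k (I ^ (m : ℕ)) (I ^ ((m : ℕ) + 1)) ⊗[k] subQuot k (J ^ (n - m)) (J ^ (n - m + 1)) :=
  LinearMap.proj m ∘ₗ (psiEquiv I J n).symm.toLinearMap

lemma psiProj_psiSum (n : ℕ) (m : Fin (n + 1)) (x : PowTensor I J n) :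
    psiProj I J n m (psiSum I J n x) = x m :=
  congrFun ((psiEquiv I J n).symm_apply_apply x) m

lemma psiProj_psi {n : ℕ} (m : Fin (n + 1)) (h : (m : ℕ) + (n - m) = n) (x) :
    psiProj I J n m (psi I J h x) = x := by
  rw [← psiSum_single, psiProj_psiSum, Pi.single_eq_same]

lemma sum_psi_psiProj (n : ℕ) (y : subQuot k (sumIJ k I J ^ n) (sumIJ k I J ^ (n + 1))) :
    ∑ m, psi I J (Nat.add_sub_cancel' (Nat.le_of_lt_succ m.2)) (psiProj I J n m y) = y := by
  obtain ⟨x, rfl⟩ := psiSum_surjective n y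
  simp_rw [psiProj_psiSum]
  exact (psiSum_apply n x).symm

lemma psiProj_mulX (n : ℕ) (m : Fin (n + 1)) (a : Fin r ⊕ Fin s) (y) :
    psiProj I J n m (mulX k (Fin r ⊕ Fin s) _ a y) =
      prodOp (mulX k (Fin r) _) (mulX k (Fin s) _) a (psiProj I J n m y) := by
  obtain ⟨x, rfl⟩ := psiSum_surjective n y
  have : mulX k (Fin r ⊕ Fin s) _ a (psiSum I J n x) = psiSum I J n
      (fun m => prodOp (mulX k (Fin r) _) (mulX k (Fin s) _) a (x m)) := by
    rw [psiSum_apply, psiSum_apply, map_sum]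
    exact Finset.sum_congr rfl fun m _ => (psi_prodOp _ a _).symm
  rw [this, psiProj_psiSum, psiProj_psiSum]

end Separation

section Grading

variable {k : Type} [Field k]

lemma homogZ.mul {σ : Type} {p q : MvPolynomial σ k} {a b : ℤ} (hp : homogZ k p a)
    (hq : homogZ k q b) : homogZ k (p * q) (a + b) := by
  obtain rfl | ⟨ha, hp⟩ := hp
  · exact Or.inl (zero_mul _)
  obtain rfl | ⟨hb, hq⟩ := hq
  · exact Or.inl (mul_zero _)
  refine Or.inr ⟨add_nonneg ha hb, ?_⟩
  rw [Int.toNat_add ha hb]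
  exact hp.mul hq

variable {r s : ℕ} {I : Ideal (PA k r)} {J : Ideal (PB k s)}

/-- The grading of the subquotient of two successive powers. -/
noncomputable abbrev powGrd {σ : Type} {I : Ideal (MvPolynomial σ k)} (hI : IsHomogeneousIdeal k I)
    (n : ℕ) : Grd (mulX k σ (subQuot k (I ^ n) (I ^ (n + 1)))) :=
  sqGrd (hI.pow n) (hI.pow (n + 1))

variable (hI : IsHomogeneousIdeal k I) (hJ : IsHomogeneousIdeal k J)

lemma proj_psi_map {m j n : ℕ} (h : m + j = n) (a b : ℤ) (x) :
    (powGrd (hI.sumIJ hJ) n).proj (a + b)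
      (psi I J h (TensorProduct.map ((powGrd hI m).proj a) ((powGrd hJ j).proj b) x)) =
      psi I J h (TensorProduct.map ((powGrd hI m).proj a) ((powGrd hJ j).proj b) x) := by
  induction x using subQuot_tensor_induction with
  | h0 => simp only [map_zero]
  | ha x y hx hy => simp only [map_add, hx, hy]
  | ht f g =>
  rw [TensorProduct.map_tmul, sqGrd_proj, sqGrd_proj, psi_tmul, sqGrd_proj]
  refine congrArg _ (Subtype.ext ?_)
  rw [coe_idealProj, coe_powMul_tmul, coe_idealProj, coe_idealProj, ← hcZ_rename, ← hcZ_rename,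
    hcZ_eq_self_iff]
  refine homogZ.mul ?_ ?_ <;> rw [← hcZ_eq_self_iff, hcZ_hcZ]

lemma exists_proj_psi {m j n : ℕ} (h : m + j = n) (e : ℤ) (x) :
    ∃ y ∈ Submodule.span k {u | ∃ v w a b, a + b = e ∧ (powGrd hI m).proj a v = v ∧
      (powGrd hJ j).proj b w = w ∧ u = v ⊗ₜ[k] w},
      (powGrd (hI.sumIJ hJ) n).proj e (psi I J h x) = psi I J h y := by
  induction x with
  | zero => exact ⟨0, Submodule.zero_mem _, by simp only [map_zero]⟩
  | add x x' hx hx' =>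
    obtain ⟨y, hy, h1⟩ := hx
    obtain ⟨y', hy', h2⟩ := hx'
    exact ⟨y + y', Submodule.add_mem _ hy hy', by rw [map_add, map_add, map_add, h1, h2]⟩
  | tmul v w =>
    obtain ⟨S, hS⟩ := (powGrd hI m).fin v
    obtain ⟨T, hT⟩ := (powGrd hJ j).fin w
    refine ⟨∑ a ∈ S, ∑ b ∈ T, if a + b = e then (powGrd hI m).proj a v ⊗ₜ (powGrd hJ j).proj b w
      else 0, Submodule.sum_mem _ fun a _ => Submodule.sum_mem _ fun b _ => ?_, ?_⟩
    · split_ifs with hab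
      · exact Submodule.subset_span ⟨_, _, a, b, hab, Grd.idem _ _ _, Grd.idem _ _ _, rfl⟩
      · exact Submodule.zero_mem _
    · conv_lhs => rw [← hS, ← hT]
      rw [TensorProduct.sum_tmul, map_sum, map_sum, map_sum]
      refine Finset.sum_congr rfl fun a _ => ?_
      rw [TensorProduct.tmul_sum, map_sum, map_sum, map_sum]
      refine Finset.sum_congr rfl fun b _ => ?_
      have h1 := proj_psi_map hI hJ h a b (v ⊗ₜ w)
      rw [TensorProduct.map_tmul] at h1
      split_ifs with hab
      · rw [← hab, h1]
      · rw [← h1, Grd.orth _ _ _ _ (Ne.symm hab), map_zero]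

lemma psiProj_proj_mem {n : ℕ} (m : Fin (n + 1)) (e : ℤ) (y) :
    psiProj I J n m ((powGrd (hI.sumIJ hJ) n).proj e y) ∈
      Submodule.span k {u | ∃ v w a b, a + b = e ∧ (powGrd hI m).proj a v = v ∧
        (powGrd hJ (n - m)).proj b w = w ∧ u = v ⊗ₜ[k] w} := by
  obtain ⟨x, rfl⟩ := psiSum_surjective n y
  choose z hz hz' using fun j : Fin (n + 1) =>
    exists_proj_psi hI hJ (Nat.add_sub_cancel' (Nat.le_of_lt_succ j.2)) e (x j)
  have : (powGrd (hI.sumIJ hJ) n).proj e (psiSum I J n x) = psiSum I J n z := by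
    rw [psiSum_apply, psiSum_apply, map_sum]
    exact Finset.sum_congr rfl fun j _ => hz' j
  rw [this, psiProj_psiSum]
  exact hz m

end Grading

section Regularity

variable {k : Type} [Field k]

section Least

variable {σ : Type} [Fintype σ] (G : CAR k σ) {M : Type} [AddCommGroup M] [Module k M]
  [Module (MvPolynomial σ k) M] [IsScalarTower k (MvPolynomial σ k) M] (g : Grd (mulX k σ M))

variable {G g} in
lemma Grd.RegLE.eq_zero {B : ℤ} (hB : ∀ t < B, g.proj t = 0) (h : g.RegLE G (B - 1)) (m : M) :
    m = 0 := by
  refine g.eq_zero_of_nakayama hB (fun m => ?_) m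
  have h1 (t : ℤ) : ∃ w, koszulD G (mulX k σ M) w = G.vac ⊗ₜ g.proj t m := by
    obtain ht | ht := lt_or_ge t B
    · exact ⟨0, by rw [hB t ht, LinearMap.zero_apply, TensorProduct.tmul_zero, map_zero]⟩
    · exact h t (by omega) _ (by rw [g.kproj_tmul, g.idem]) (koszulD_vac _)
  choose w hw using h1
  obtain ⟨s, hs⟩ := g.fin m
  obtain ⟨u, hu⟩ := exists_of_koszulD_eq_vac (w := ∑ t ∈ s, w t) (m := m) (by
    rw [map_sum, Finset.sum_congr rfl fun t _ => hw t, ← TensorProduct.tmul_sum, hs])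
  exact ⟨Finset.univ, u, hu⟩

lemma Grd.exists_regLE [Module.Finite (MvPolynomial σ k) M] : ∃ r, g.RegLE G r := by
  obtain ⟨F, -⟩ := exists_gradedFreeRes G g
  obtain ⟨N, hN⟩ := F.bdd
  have hfin : (Set.range fun x : Σ i : Fin N, Fin (F.rk i) => F.tw x.1 x.2 - (x.1 : ℤ)).Finite :=
    Set.finite_range _
  obtain ⟨r, hr⟩ := hfin.bddAbove
  refine ⟨r, F.regLE g fun i l => ?_⟩
  by_cases hi : i < N
  · exact hr ⟨⟨⟨i, hi⟩, l⟩, rfl⟩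
  · rw [hN i (by omega)] at l
    exact l.elim0

lemma Grd.exists_isLeast_regLE [Module.Finite (MvPolynomial σ k) M] [Nontrivial M] {B : ℤ}
    (hB : ∀ t < B, g.proj t = 0) : ∃ r, IsLeast {r | g.RegLE G r} r := by
  obtain ⟨m, hm⟩ := exists_ne (0 : M)
  refine (Int.exists_least_of_bdd ⟨B, fun z hz => ?_⟩ (g.exists_regLE G)).imp fun r hr => hr
  by_contra! h
  exact hm ((hz.mono (by omega)).eq_zero hB m)

end Least

variable {r s : ℕ} {I : Ideal (PA k r)} {J : Ideal (PB k s)}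

lemma nontrivial_subQuot_pow {I : Ideal (PA k r)} (hI0 : I ≠ ⊥) (hI1 : I ≠ ⊤) (n : ℕ) :
    Nontrivial (subQuot k (I ^ n) (I ^ (n + 1))) := by
  by_contra h
  rw [not_nontrivial_iff_subsingleton] at h
  have h1 : I ^ n ≤ I ^ (n + 1) := fun f hf =>
    (sqMk_eq_zero_iff (q := I ^ (n + 1)) ⟨f, hf⟩).1 (Subsingleton.elim _ _)
  have h2 : ∀ j, I ^ n ≤ I ^ (n + j) := by
    intro j
    induction j with
    | zero => rfl
    | succ j ih =>
      refine ih.trans ?_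
      rw [pow_add, ← add_assoc, add_right_comm, pow_add _ (n + 1)]
      exact Ideal.mul_mono_left h1
  have h3 : I ^ n ≤ ⨅ j, I ^ j :=
    le_iInf fun j => (h2 j).trans (Ideal.pow_le_pow_right (Nat.le_add_left _ _))
  rw [Ideal.iInf_pow_eq_bot_of_isDomain I hI1, le_bot_iff] at h3
  exact hI0 (eq_zero_of_pow_eq_zero h3)

variable (G : CAR k (Fin r)) (H : CAR k (Fin s))
variable (hI : IsHomogeneousIdeal k I) (hJ : IsHomogeneousIdeal k J)

lemma psiProj_kproj_mem {n : ℕ} (m : Fin (n + 1)) (e : ℤ)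
    (z : (G.sum H).Λ ⊗[k] subQuot k (sumIJ k I J ^ n) (sumIJ k I J ^ (n + 1))) :
    (psiProj I J n m).lTensor (G.sum H).Λ ((powGrd (hI.sumIJ hJ) n).kproj (G.sum H) e z) ∈
      Submodule.span k {u | ∃ (l : (G.sum H).Λ) (v : _) (w : _) (a b : ℤ), a + b = e ∧
        (powGrd hI m).proj a v = v ∧ (powGrd hJ (n - m)).proj b w = w ∧ u = l ⊗ₜ (v ⊗ₜ w)} := by
  induction z with
  | zero => simp only [map_zero, Submodule.zero_mem]
  | add x y hx hy =>
    rw [map_add, map_add]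
    exact Submodule.add_mem _ hx hy
  | tmul l y =>
    rw [Grd.kproj_tmul, LinearMap.lTensor_tmul]
    refine (Submodule.map_span_le (TensorProduct.mk k (G.sum H).Λ _ l) _ _).2 ?_
      (Submodule.mem_map_of_mem (psiProj_proj_mem hI hJ m e y))
    rintro _ ⟨v, w, a, b, hab, hv, hw, rfl⟩
    exact Submodule.subset_span ⟨l, v, w, a, b, hab, hv, hw, rfl⟩

variable {G H hI hJ}

lemma regLE_sumIJ {n : ℕ} {α β : Fin (n + 1) → ℤ} {ρ : ℤ}
    (hα : ∀ m : Fin (n + 1), (powGrd hI (m : ℕ)).RegLE G (α m))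
    (hβ : ∀ m : Fin (n + 1), (powGrd hJ (n - m)).RegLE H (β m))
    (hρ : ∀ m, α m + β m ≤ ρ) : (powGrd (hI.sumIJ hJ) n).RegLE (G.sum H) ρ := by
  intro t ht z hz hdz
  have h1 (m : Fin (n + 1)) := kunneth_upper (powGrd hI (m : ℕ)) (powGrd hJ (n - m)) mulX_comm
    mulX_comm (hα m) (hβ m) (fun _ => sqGrd_proj_of_neg _ _) (fun _ => sqGrd_proj_of_neg _ _)
    (lt_of_le_of_lt (hρ m) ht) (z := (psiProj I J n m).lTensor (G.sum H).Λ z)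
    (by rw [← hz]; exact psiProj_kproj_mem G H hI hJ m t z)
    (by rw [koszulD_lTensor (G.sum H) _ (psiProj_mulX n m), hdz, map_zero])
  choose w hw using h1
  refine ⟨∑ m, (psi I J (Nat.add_sub_cancel' (Nat.le_of_lt_succ m.2))).lTensor (G.sum H).Λ (w m),
    ?_⟩
  have h2 : ∀ z : (G.sum H).Λ ⊗[k] subQuot k (sumIJ k I J ^ n) (sumIJ k I J ^ (n + 1)),
      ∑ m, (psi I J (Nat.add_sub_cancel' (Nat.le_of_lt_succ m.2))).lTensor (G.sum H).Λ
        ((psiProj I J n m).lTensor (G.sum H).Λ z) = z := by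
    intro z
    induction z with
    | zero => simp only [map_zero, Finset.sum_const_zero]
    | add x y hx hy => simp only [map_add, Finset.sum_add_distrib, hx, hy]
    | tmul l y =>
      simp only [LinearMap.lTensor_tmul]
      rw [← TensorProduct.tmul_sum, sum_psi_psiProj]
  rw [map_sum]
  refine Eq.trans (Finset.sum_congr rfl fun m _ => ?_) (h2 z)
  rw [koszulD_lTensor (G.sum H) _ (psi_prodOp _), hw]

lemma add_le_of_regLE_sumIJ {n : ℕ} {m : Fin (n + 1)} {a b ρ : ℤ}
    (ha : ¬ (powGrd hI m).RegLE G (a - 1)) (hb : ¬ (powGrd hJ (n - m)).RegLE H (b - 1))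
    (hρ : (powGrd (hI.sumIJ hJ) n).RegLE (G.sum H) ρ) : a + b ≤ ρ := by
  have h : (m : ℕ) + (n - m) = n := Nat.add_sub_cancel' (Nat.le_of_lt_succ m.2)
  unfold Grd.RegLE at ha hb
  push Not at ha hb
  obtain ⟨t, ht, z, hz, hdz, hz'⟩ := ha
  obtain ⟨t', ht', w, hw, hdw, hw'⟩ := hb
  by_contra! hlt
  obtain ⟨u, hu, hdu, hu'⟩ := kunneth_lower _ _ hz hw hdz hdw hz' hw'
  obtain ⟨y, hy⟩ := hρ (t + t') (by omega) ((psi I J h).lTensor (G.sum H).Λ u) (by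
      rw [← hu]
      generalize u = u
      induction u with
      | zero => simp only [map_zero]
      | add x y hx hy => simp only [map_add, hx, hy]
      | tmul l y =>
        rw [LinearMap.lTensor_tmul, LinearMap.lTensor_tmul, Grd.kproj_tmul, proj_psi_map])
    (by rw [koszulD_lTensor (G.sum H) _ (psi_prodOp _), hdu, map_zero])
  refine hu' ((psiProj I J n m).lTensor (G.sum H).Λ y) ?_
  rw [koszulD_lTensor (G.sum H) _ (psiProj_mulX n _), hy, ← LinearMap.comp_apply,
    ← LinearMap.lTensor_comp]
  have : psiProj I J n m ∘ₗ psi I J h = LinearMap.id :=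
    LinearMap.ext fun x => psiProj_psi m h x
  rw [this, LinearMap.lTensor_id]
  rfl

lemma isLeast_regSubQuot_pow (G : CAR k (Fin r)) (hI : IsHomogeneousIdeal k I) (hI0 : I ≠ ⊥)
    (hI1 : I ≠ ⊤) (n : ℕ) :
    IsLeast {ρ | (powGrd hI n).RegLE G ρ} (regSubQuot k (I ^ n) (I ^ (n + 1))) := by
  have := nontrivial_subQuot_pow hI0 hI1 n
  obtain ⟨ρ, hρ⟩ := (powGrd hI n).exists_isLeast_regLE G (B := 0)
    fun _ => sqGrd_proj_of_neg _ _
  rwa [regSubQuot_eq G (hI.pow n) (hI.pow (n + 1)), hρ.csInf_eq]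

end Regularity

end PaperHTT

open PaperHTT in
/-- Theorem 3.3(ii): for `n ≥ 1`,
`reg (I+J)^n/(I+J)^(n+1) = max_(i+j=n) (reg I^i/I^(i+1) + reg J^j/J^(j+1))`. -/
theorem reg_successive_quot_eq
    (k : Type) [Field k] (r s : ℕ)
    (I : Ideal (PA k r)) (J : Ideal (PB k s))
    (hI0 : I ≠ ⊥) (hI1 : I ≠ ⊤) (hIh : IsHomogeneousIdeal k I)
    (hJ0 : J ≠ ⊥) (hJ1 : J ≠ ⊤) (hJh : IsHomogeneousIdeal k J)
    (n : ℕ) (hn : 1 ≤ n) :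
    regSubQuot k ((sumIJ k I J) ^ n) ((sumIJ k I J) ^ (n + 1)) =
      sSup {v : ℤ | ∃ i j : ℕ, i + j = n ∧
        v = regSubQuot k (I ^ i) (I ^ (i + 1)) + regSubQuot k (J ^ j) (J ^ (j + 1))} := by
  let G := CAR.fin (k := k) r
  let H := CAR.fin (k := k) s
  have hα := isLeast_regSubQuot_pow G hIh hI0 hI1
  have hβ := isLeast_regSubQuot_pow H hJh hJ0 hJ1
  rw [regSubQuot_eq (G.sum H) ((hIh.sumIJ hJh).pow n) ((hIh.sumIJ hJh).pow (n + 1))]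
  have hS : {v : ℤ | ∃ i j : ℕ, i + j = n ∧
      v = regSubQuot k (I ^ i) (I ^ (i + 1)) + regSubQuot k (J ^ j) (J ^ (j + 1))} =
      Set.range fun m : Fin (n + 1) => regSubQuot k (I ^ (m : ℕ)) (I ^ ((m : ℕ) + 1)) +
        regSubQuot k (J ^ (n - m)) (J ^ (n - m + 1)) := by
    ext v
    constructor
    · rintro ⟨i, j, rfl, rfl⟩
      exact ⟨⟨i, by omega⟩, by simp only [Nat.add_sub_cancel_left]⟩
    · rintro ⟨m, rfl⟩
      exact ⟨m, n - m, by omega, rfl⟩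
  rw [hS]
  refine IsLeast.csInf_eq ⟨regLE_sumIJ (fun m => (hα m).1) (fun m => (hβ (n - m)).1)
    fun m => le_csSup (Set.finite_range _).bddAbove ⟨m, rfl⟩, fun ρ hρ => ?_⟩
  refine csSup_le (Set.range_nonempty _) ?_
  rintro _ ⟨m, rfl⟩
  refine add_le_of_regLE_sumIJ (hI := hIh) (hJ := hJh) (m := m) (fun h => ?_)
    (fun h => ?_) hρ
  · have := (hα m).2 h
    omega
  · have := (hβ (n - m)).2 h
    omega
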